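/- arXiv:1304.6924 — 2 statements merged into one kernel-verified Lean document; each statement's English description precedes it below -/
import Mathlib

section
/- Sparse Laplace regime. Let φ_L(x) = (1/2)e^{-|x|} be the Laplace density. Let α ∈ (0,1), β ∈ (0,1-α). Let 1/2 < δ < 1 and 0 < r < 1 with r > r*(δ) := 2δ - 1. Let ε_n and τ_n be sequences with ε_n/n^{-δ} → 1 and τ_n/(r·log n) → 1 as n → ∞. For each n let X₁,…,Xₙ be i.i.d. with density f_n(x) = (1-ε_n)φ_L(x-μ₁) + ε_n φ_L(x-μ₂) where μ₂ - μ₁ = τ_n. Then, for n large enough, P_{f_n}(Ψ_α = 0) ≤ β. -/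
open MeasureTheory Filter Set

noncomputable section

/-- The measure on `ℝ` with Lebesgue density `f`. -/
def pdfMeasure (f : ℝ → ℝ) : Measure ℝ :=
  MeasureTheory.volume.withDensity (fun x => ENNReal.ofReal (f x))

/-- The joint law of `n` i.i.d. observations with common density `f`. -/
def sampleMeasure (n : ℕ) (f : ℝ → ℝ) : Measure (Fin n → ℝ) :=
  Measure.pi (fun _ : Fin n => pdfMeasure f)

/-- The `k`-th order statistic (for `1 ≤ k ≤ n`) of the sample `ω`. -/
def oStat {n : ℕ} (k : ℕ) (ω : Fin n → ℝ) : ℝ :=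
  if h : 1 ≤ k ∧ k ≤ n then ω (Tuple.sort ω ⟨k - 1, by omega⟩) else 0

/-- The spacing `X_{(n-k+1)} - X_{(k)}` of the order statistics. -/
def spacing {n : ℕ} (k : ℕ) (ω : Fin n → ℝ) : ℝ :=
  oStat (n - k + 1) ω - oStat k ω

/-- `K_n = {2^j : 0 ≤ j ≤ ⌊log₂ (n/2)⌋}`. -/
def Kfin (n : ℕ) : Finset ℕ :=
  (Finset.range (Nat.log 2 (n / 2) + 1)).image (fun j => 2 ^ j)

/-- The `(1-u)`-quantile of the spacing `X_{(n-k+1)} - X_{(k)}` under the null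
hypothesis (sample of density `φ`; under `H₀` this law does not depend on the
translation parameter). -/
def spacingQuantile (n : ℕ) (φ : ℝ → ℝ) (u : ℝ) (k : ℕ) : ℝ :=
  sInf {t : ℝ | sampleMeasure n φ {ω | spacing k ω > t} ≤ ENNReal.ofReal u}

/-- The corrected level `α_n`. -/
def alphaN (n : ℕ) (φ : ℝ → ℝ) (α : ℝ) : ℝ :=
  sSup {u : ℝ | u ∈ Set.Ioo (0:ℝ) 1 ∧
    sampleMeasure n φ {ω | ∃ k ∈ Kfin n, spacing k ω > spacingQuantile n φ u k}
      ≤ ENNReal.ofReal α}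

/-- The rejection region of the multiple spacing test `Ψ_α`. -/
def psiReject (n : ℕ) (φ : ℝ → ℝ) (α : ℝ) : Set (Fin n → ℝ) :=
  {ω | ∃ k ∈ Kfin n, spacing k ω > spacingQuantile n φ (alphaN n φ α) k}

/-- The empirical (unbiased) variance `S_n²`. -/
def varStat {n : ℕ} (ω : Fin n → ℝ) : ℝ :=
  (∑ i, (ω i - (∑ j, ω j) / (n : ℝ)) ^ 2) / ((n : ℝ) - 1)

/-- The `(1-α)`-quantile of `S_n²` under the null hypothesis. -/
def varQuantile (n : ℕ) (φ : ℝ → ℝ) (α : ℝ) : ℝ :=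
  sInf {t : ℝ | sampleMeasure n φ {ω | varStat ω > t} ≤ ENNReal.ofReal α}

/-- The standard Gaussian density. -/
def phiG (x : ℝ) : ℝ := (Real.sqrt (2 * Real.pi))⁻¹ * Real.exp (-x ^ 2 / 2)

/-- A two-component Gaussian mixture density. -/
def mixG (ε μ₁ μ₂ : ℝ) : ℝ → ℝ := fun x => (1 - ε) * phiG (x - μ₁) + ε * phiG (x - μ₂)

/-- Survival function `Φ̄ = 1 - Φ` of the density `φ`. -/
def Phibar (φ : ℝ → ℝ) (u : ℝ) : ℝ := 1 - ∫ x in Set.Iic u, φ x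

/-- The standard Laplace density. -/
def phiL (x : ℝ) : ℝ := (1 / 2) * Real.exp (-|x|)

/-- A two-component Laplace mixture density. -/
def mixL (ε μ₁ μ₂ : ℝ) : ℝ → ℝ := fun x => (1 - ε) * phiL (x - μ₁) + ε * phiL (x - μ₂)

/-- The threshold `ρ(k,n) = k/n + (1 + √(1+2kβ))/(nβ)`. -/
def rhoKn (n k : ℕ) (β : ℝ) : ℝ :=
  ((k : ℝ) / (n : ℝ)) + (1 + Real.sqrt (1 + 2 * (k : ℝ) * β)) / ((n : ℝ) * β)

open Real in
theorem phiL_sub_of_le {c x : ℝ} (h : c ≤ x) : phiL (x - c) = 1 / 2 * exp c * exp (-x) := by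
  rw [phiL, abs_of_nonneg (sub_nonneg.2 h), neg_sub, sub_eq_add_neg, exp_add, mul_assoc]

open Real in
theorem phiL_sub_of_ge {c x : ℝ} (h : x ≤ c) : phiL (x - c) = 1 / 2 * exp (-c) * exp x := by
  rw [phiL, abs_of_nonpos (sub_nonpos.2 h), neg_neg, sub_eq_neg_add, exp_add, mul_assoc]

theorem integrableOn_phiL_sub_Ioi (c : ℝ) : IntegrableOn (fun x => phiL (x - c)) (Ioi c) :=
  IntegrableOn.congr_fun ((integrableOn_exp_neg_Ioi c).const_mul _)
    (fun _ hx => (phiL_sub_of_le (le_of_lt hx)).symm) measurableSet_Ioi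

theorem integrableOn_phiL_sub_Iic (c : ℝ) : IntegrableOn (fun x => phiL (x - c)) (Iic c) :=
  IntegrableOn.congr_fun ((integrableOn_exp_Iic c).const_mul _)
    (fun _ hx => (phiL_sub_of_ge hx).symm) measurableSet_Iic

open Real in
theorem integral_phiL_sub_Ioi {c t : ℝ} (h : c ≤ t) :
    ∫ x in Ioi t, phiL (x - c) = exp (-(t - c)) / 2 := by
  rw [setIntegral_congr_fun measurableSet_Ioi fun x hx => phiL_sub_of_le (h.trans (le_of_lt hx)),
    integral_const_mul, integral_exp_neg_Ioi, neg_sub, sub_eq_add_neg, exp_add]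
  ring

open Real in
theorem integral_phiL_sub_Iic {c t : ℝ} (h : t ≤ c) :
    ∫ x in Iic t, phiL (x - c) = exp (t - c) / 2 := by
  rw [setIntegral_congr_fun measurableSet_Iic fun x hx => phiL_sub_of_ge (le_trans hx h),
    integral_const_mul, integral_exp_Iic, sub_eq_add_neg, exp_add]
  ring

theorem integrable_phiL_sub (c : ℝ) : Integrable (fun x => phiL (x - c)) := by
  rw [← integrableOn_univ, ← Iic_union_Ioi (a := c)]
  exact (integrableOn_phiL_sub_Iic c).union (integrableOn_phiL_sub_Ioi c)

theorem integral_phiL_sub (c : ℝ) : ∫ x, phiL (x - c) = 1 := by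
  rw [← setIntegral_univ, ← Iic_union_Ioi (a := c),
    setIntegral_union (Iic_disjoint_Ioi le_rfl) measurableSet_Ioi (integrableOn_phiL_sub_Iic c)
      (integrableOn_phiL_sub_Ioi c), integral_phiL_sub_Iic le_rfl, integral_phiL_sub_Ioi le_rfl]
  norm_num

section Mixture

variable {ε μ₁ μ₂ : ℝ}

theorem mixL_nonneg (hε₀ : 0 ≤ ε) (hε₁ : ε ≤ 1) (x : ℝ) : 0 ≤ mixL ε μ₁ μ₂ x := by
  have := sub_nonneg.2 hε₁
  unfold mixL phiL
  positivity

theorem integrable_mixL (ε μ₁ μ₂ : ℝ) : Integrable (mixL ε μ₁ μ₂) :=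
  ((integrable_phiL_sub μ₁).const_mul (1 - ε)).add ((integrable_phiL_sub μ₂).const_mul ε)

theorem setIntegral_mixL (ε μ₁ μ₂ : ℝ) (A : Set ℝ) :
    ∫ x in A, mixL ε μ₁ μ₂ x
      = (1 - ε) * (∫ x in A, phiL (x - μ₁)) + ε * ∫ x in A, phiL (x - μ₂) := by
  unfold mixL
  rw [integral_add ((integrable_phiL_sub μ₁).const_mul _).integrableOn
    ((integrable_phiL_sub μ₂).const_mul _).integrableOn, integral_const_mul, integral_const_mul]

theorem pdfMeasure_mixL_apply (hε₀ : 0 ≤ ε) (hε₁ : ε ≤ 1) {A : Set ℝ} (hA : MeasurableSet A) :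
    pdfMeasure (mixL ε μ₁ μ₂) A = ENNReal.ofReal (∫ x in A, mixL ε μ₁ μ₂ x) := by
  rw [pdfMeasure, withDensity_apply _ hA,
    ofReal_integral_eq_lintegral_ofReal (integrable_mixL _ _ _).integrableOn
      (Eventually.of_forall (mixL_nonneg hε₀ hε₁))]

theorem real_pdfMeasure_mixL (hε₀ : 0 ≤ ε) (hε₁ : ε ≤ 1) {A : Set ℝ} (hA : MeasurableSet A) :
    (pdfMeasure (mixL ε μ₁ μ₂)).real A
      = (1 - ε) * (∫ x in A, phiL (x - μ₁)) + ε * ∫ x in A, phiL (x - μ₂) := by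
  rw [measureReal_def, pdfMeasure_mixL_apply hε₀ hε₁ hA, ENNReal.toReal_ofReal
    (integral_nonneg (mixL_nonneg hε₀ hε₁)), setIntegral_mixL]

theorem isProbabilityMeasure_pdfMeasure_mixL (hε₀ : 0 ≤ ε) (hε₁ : ε ≤ 1) :
    IsProbabilityMeasure (pdfMeasure (mixL ε μ₁ μ₂)) := by
  constructor
  rw [pdfMeasure_mixL_apply hε₀ hε₁ MeasurableSet.univ, setIntegral_mixL, setIntegral_univ,
    setIntegral_univ, integral_phiL_sub, integral_phiL_sub]
  simp

open Real in
theorem real_pdfMeasure_mixL_Ioi (hε₀ : 0 ≤ ε) (hε₁ : ε ≤ 1) {τ a : ℝ} (ha : 0 ≤ a)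
    (hτa : τ ≤ a) :
    (pdfMeasure (mixL ε μ₁ (μ₁ + τ))).real (Ioi (μ₁ + a))
      = exp (-a) / 2 * (1 + ε * (exp τ - 1)) := by
  rw [real_pdfMeasure_mixL hε₀ hε₁ measurableSet_Ioi, integral_phiL_sub_Ioi (by linarith),
    integral_phiL_sub_Ioi (by linarith), add_sub_cancel_left,
    show -(μ₁ + a - (μ₁ + τ)) = -a + τ by ring, exp_add]
  ring

open Real in
theorem real_pdfMeasure_mixL_Iio (hε₀ : 0 ≤ ε) (hε₁ : ε ≤ 1) {τ a : ℝ} (hτ : 0 ≤ τ)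
    (ha : 0 ≤ a) :
    (pdfMeasure (mixL ε μ₁ (μ₁ + τ))).real (Iio (μ₁ - a))
      = exp (-a) / 2 * (1 - ε + ε * exp (-τ)) := by
  rw [real_pdfMeasure_mixL hε₀ hε₁ measurableSet_Iio, ← integral_Iic_eq_integral_Iio,
    ← integral_Iic_eq_integral_Iio, integral_phiL_sub_Iic (by linarith),
    integral_phiL_sub_Iic (by linarith), show μ₁ - a - μ₁ = -a by ring,
    show μ₁ - a - (μ₁ + τ) = -a + -τ by ring, exp_add]
  ring

end Mixture

theorem mixL_zero : mixL 0 0 (0 + 0) = phiL := by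
  funext x
  simp [mixL]

/-- The number of sample points falling into `A`. -/
def countIn {n : ℕ} (A : Set ℝ) (ω : Fin n → ℝ) : ℝ := ∑ i, A.indicator 1 (ω i)

theorem card_le_countIn {n : ℕ} {A : Set ℝ} {ω : Fin n → ℝ} (s : Finset (Fin n))
    (hs : ∀ i ∈ s, ω i ∈ A) : (s.card : ℝ) ≤ countIn A ω := by
  calc (s.card : ℝ) = ∑ i ∈ s, A.indicator 1 (ω i) := by
        rw [Finset.sum_congr rfl fun i hi => Set.indicator_of_mem (hs i hi) 1]
        simp
    _ ≤ countIn A ω := Finset.sum_le_sum_of_subset_of_nonneg (Finset.subset_univ s)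
        fun i _ _ => Set.indicator_nonneg (fun _ _ => zero_le_one) _

theorem countIn_add_countIn_compl {n : ℕ} (A : Set ℝ) (ω : Fin n → ℝ) :
    countIn A ω + countIn Aᶜ ω = n := by
  have h : ∀ x, A.indicator (1 : ℝ → ℝ) x + Aᶜ.indicator 1 x = 1 := fun x =>
    congrFun (Set.indicator_self_add_compl A 1) x
  rw [countIn, countIn, ← Finset.sum_add_distrib, Finset.sum_congr rfl fun i _ => h (ω i)]
  simp

section OrderStatistics

variable {n k : ℕ} {ω : Fin n → ℝ} {A : Set ℝ}

theorem le_countIn_of_oStat_mem_of_isLowerSet (hA : IsLowerSet A) (hk : 1 ≤ k) (hkn : k ≤ n)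
    (h : oStat k ω ∈ A) : (k : ℝ) ≤ countIn A ω := by
  rw [oStat, dif_pos ⟨hk, hkn⟩] at h
  have hcard : ((Finset.Iic (⟨k - 1, by omega⟩ : Fin n)).map
      (Tuple.sort ω).toEmbedding).card = k := by
    rw [Finset.card_map, Fin.card_Iic]
    exact Nat.sub_add_cancel hk
  have := card_le_countIn (A := A) (ω := ω) ((Finset.Iic (⟨k - 1, by omega⟩ : Fin n)).map
      (Tuple.sort ω).toEmbedding) (by
    intro i hi
    obtain ⟨j, hj, rfl⟩ := Finset.mem_map.1 hi
    exact hA (Tuple.monotone_sort ω (Finset.mem_Iic.1 hj)) h)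
  rwa [hcard] at this

theorem le_countIn_of_oStat_mem_of_isUpperSet (hA : IsUpperSet A) (hk : 1 ≤ k) (hkn : k ≤ n)
    (h : oStat (n - k + 1) ω ∈ A) : (k : ℝ) ≤ countIn A ω := by
  rw [oStat, dif_pos ⟨by omega, by omega⟩] at h
  have hcard : ((Finset.Ici (⟨n - k + 1 - 1, by omega⟩ : Fin n)).map
      (Tuple.sort ω).toEmbedding).card = k := by
    rw [Finset.card_map, Fin.card_Ici]
    change n - (n - k + 1 - 1) = k
    omega
  have := card_le_countIn (A := A) (ω := ω) ((Finset.Ici (⟨n - k + 1 - 1, by omega⟩ : Fin n)).map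
      (Tuple.sort ω).toEmbedding) (by
    intro i hi
    obtain ⟨j, hj, rfl⟩ := Finset.mem_map.1 hi
    exact hA (Tuple.monotone_sort ω (Finset.mem_Ici.1 hj)) h)
  rwa [hcard] at this

theorem countIn_Ioi_le_of_oStat_le {a : ℝ} (hk : 1 ≤ k) (hkn : k ≤ n)
    (h : oStat (n - k + 1) ω ≤ a) : countIn (Ioi a) ω ≤ k - 1 := by
  have h₁ := le_countIn_of_oStat_mem_of_isLowerSet (isLowerSet_Iic a) (by omega) (by omega) h
  have h₂ := countIn_add_countIn_compl (Iic a) ω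
  rw [compl_Iic] at h₂
  push_cast [Nat.cast_sub hkn] at h₁
  linarith

theorem countIn_Iio_le_of_le_oStat {a : ℝ} (hk : 1 ≤ k) (hkn : k ≤ n)
    (h : a ≤ oStat k ω) : countIn (Iio a) ω ≤ k - 1 := by
  have h₁ := le_countIn_of_oStat_mem_of_isUpperSet (k := n - k + 1) (isUpperSet_Ici a) (by omega)
    (by omega) (show a ≤ oStat (n - (n - k + 1) + 1) ω by
      rwa [show n - (n - k + 1) + 1 = k by omega])
  have h₂ := countIn_add_countIn_compl (Ici a) ω
  rw [compl_Ici] at h₂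
  push_cast [Nat.cast_sub hkn] at h₁
  linarith

end OrderStatistics

section Chebyshev

open ProbabilityTheory

variable {n : ℕ} {ν : Measure ℝ} [IsProbabilityMeasure ν] {A : Set ℝ} {c : ℝ}

theorem measure_le_abs_countIn_sub_le (hA : MeasurableSet A) (hc : 0 < c) :
    Measure.pi (fun _ : Fin n => ν) {ω | c ≤ |countIn A ω - n * ν.real A|}
      ≤ ENNReal.ofReal (n * ν.real A / c ^ 2) := by
  have hmem : MemLp (A.indicator (1 : ℝ → ℝ)) 2 ν := memLp_indicator_const 2 hA 1 (by simp)
  have hvar : Var[A.indicator (1 : ℝ → ℝ); ν] ≤ ν.real A := by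
    refine (variance_le_expectation_sq hmem.aestronglyMeasurable).trans_eq ?_
    rw [← integral_indicator_one hA]
    congr 1
    funext x
    by_cases hx : x ∈ A <;> simp [hx]
  have hfun : (∑ i : Fin n, fun ω : Fin n → ℝ => A.indicator (1 : ℝ → ℝ) (ω i)) = countIn A := by
    funext ω
    simp [countIn]
  have hcomp (i : Fin n) : MemLp (fun ω : Fin n → ℝ => A.indicator (1 : ℝ → ℝ) (ω i)) 2
      (Measure.pi fun _ => ν) :=
    hmem.comp_measurePreserving (measurePreserving_eval (fun _ : Fin n => ν) i)
  have hsum : Var[countIn A; Measure.pi fun _ : Fin n => ν] ≤ n * ν.real A := by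
    rw [← hfun, variance_sum_pi (X := fun _ => A.indicator (1 : ℝ → ℝ)) fun _ => hmem]
    simpa using mul_le_mul_of_nonneg_left hvar n.cast_nonneg
  have hmean : ∫ ω, countIn A ω ∂(Measure.pi fun _ : Fin n => ν) = n * ν.real A := by
    simp only [countIn]
    rw [integral_finsetSum _ fun i _ => (hcomp i).integrable one_le_two]
    have (i : Fin n) : ∫ ω : Fin n → ℝ, A.indicator (1 : ℝ → ℝ) (ω i) ∂(Measure.pi fun _ => ν)
        = ν.real A := by
      rw [← integral_indicator_one hA]
      exact integral_comp_eval (μ := fun _ : Fin n => ν) (i := i) hmem.aestronglyMeasurable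
    simp [this]
  have hL : MemLp (countIn A) 2 (Measure.pi fun _ : Fin n => ν) :=
    hfun ▸ memLp_finsetSum' _ fun i _ => hcomp i
  have := meas_ge_le_variance_div_sq hL hc
  rw [hmean] at this
  exact this.trans (ENNReal.ofReal_le_ofReal (by gcongr))

theorem measure_le_countIn_le {m k : ℝ} (hA : MeasurableSet A) (hm : n * ν.real A ≤ m)
    (hmk : m < k) :
    Measure.pi (fun _ : Fin n => ν) {ω | k ≤ countIn A ω}
      ≤ ENNReal.ofReal (m / (k - m) ^ 2) := by
  refine (measure_mono ?_).trans ((measure_le_abs_countIn_sub_le hA (sub_pos.2 hmk)).trans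
    (ENNReal.ofReal_le_ofReal (by gcongr)))
  intro ω (hω : k ≤ countIn A ω)
  exact (show k - m ≤ countIn A ω - n * ν.real A by linarith).trans (le_abs_self _)

theorem measure_countIn_le_le {m k : ℝ} (hA : MeasurableSet A) (hm : m ≤ n * ν.real A)
    (hk : 0 ≤ k) (hkm : k < m) :
    Measure.pi (fun _ : Fin n => ν) {ω | countIn A ω ≤ k}
      ≤ ENNReal.ofReal (m / (m - k) ^ 2) := by
  have hkx := hkm.trans_le hm
  refine (measure_mono ?_).trans ((measure_le_abs_countIn_sub_le hA (sub_pos.2 hkx)).trans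
    (ENNReal.ofReal_le_ofReal ?_))
  · intro ω (hω : countIn A ω ≤ k)
    exact (show n * ν.real A - k ≤ -(countIn A ω - n * ν.real A) by linarith).trans (neg_le_abs _)
  · rw [div_le_div_iff₀ (pow_pos (sub_pos.2 hkx) 2) (pow_pos (sub_pos.2 hkm) 2)]
    nlinarith [mul_nonneg (sub_nonneg.2 hm)
      (sub_nonneg.2 (mul_le_mul hkm.le hkx.le hk (hk.trans hkm.le)))]

end Chebyshev

open Real in
theorem sampleMeasure_phiL_spacing_gt_le {n k : ℕ} (hk : 1 ≤ k) (hkn : k ≤ n) {a m : ℝ}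
    (ha : 0 ≤ a) (hm : n * (exp (-a) / 2) = m) (hmk : m < k) :
    sampleMeasure n phiL {ω | spacing k ω > 2 * a} ≤ ENNReal.ofReal (2 * (m / (k - m) ^ 2)) := by
  have := isProbabilityMeasure_pdfMeasure_mixL (ε := 0) (μ₁ := 0) (μ₂ := 0 + 0) le_rfl zero_le_one
  have hm₀ : 0 ≤ m := hm ▸ by positivity
  rw [← mixL_zero, two_mul (m / _), ENNReal.ofReal_add (by positivity) (by positivity)]
  refine (measure_mono ?_).trans ((measure_union_le _ _).trans (add_le_add
    (measure_le_countIn_le (A := Ioi (0 + a)) (k := k) measurableSet_Ioi ?_ hmk)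
    (measure_le_countIn_le (A := Iio (0 - a)) (k := k) measurableSet_Iio ?_ hmk)))
  · intro ω (hω : spacing k ω > 2 * a)
    rw [spacing] at hω
    by_cases h : oStat (n - k + 1) ω > 0 + a
    · exact Or.inl (le_countIn_of_oStat_mem_of_isUpperSet (isUpperSet_Ioi _) hk hkn h)
    · exact Or.inr (le_countIn_of_oStat_mem_of_isLowerSet (isLowerSet_Iio _) hk hkn
        (show oStat k ω < 0 - a by linarith))
  · rw [real_pdfMeasure_mixL_Ioi le_rfl zero_le_one ha ha, zero_mul, add_zero, mul_one, hm]
  · rw [real_pdfMeasure_mixL_Iio le_rfl zero_le_one le_rfl ha, zero_mul, add_zero, sub_zero,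
      mul_one, hm]

open Real in
theorem sampleMeasure_mixL_spacing_le_le {n k : ℕ} (hk : 1 ≤ k) (hkn : k ≤ n)
    {ε μ₁ τ a s M : ℝ} (hε₀ : 0 ≤ ε) (hε₁ : ε ≤ 1) (hτ : 0 ≤ τ) (hτa : τ ≤ a + s) (hsa : s ≤ a)
    (hkM : k < M) (hlower : M ≤ n * (exp (-(a - s)) / 2 * (1 - ε)))
    (hupper : M ≤ n * (exp (-(a + s)) / 2 * (1 + ε * (exp τ - 1)))) :
    sampleMeasure n (mixL ε μ₁ (μ₁ + τ)) {ω | spacing k ω ≤ 2 * a}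
      ≤ ENNReal.ofReal (2 * (M / (M - k) ^ 2)) := by
  have := isProbabilityMeasure_pdfMeasure_mixL (μ₁ := μ₁) (μ₂ := μ₁ + τ) hε₀ hε₁
  have hM₀ : 0 ≤ M := k.cast_nonneg.trans hkM.le
  rw [two_mul (M / _), ENNReal.ofReal_add (by positivity) (by positivity)]
  refine (measure_mono ?_).trans ((measure_union_le _ _).trans (add_le_add
    (measure_countIn_le_le (A := Iio (μ₁ - (a - s))) measurableSet_Iio ?_ k.cast_nonneg hkM)
    (measure_countIn_le_le (A := Ioi (μ₁ + (a + s))) measurableSet_Ioi ?_ k.cast_nonneg hkM)))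
  · intro ω (hω : spacing k ω ≤ 2 * a)
    rw [spacing] at hω
    rcases le_or_gt (μ₁ - (a - s)) (oStat k ω) with h | h
    · exact Or.inl ((countIn_Iio_le_of_le_oStat hk hkn h).trans (by linarith))
    · exact Or.inr ((countIn_Ioi_le_of_oStat_le hk hkn (by linarith)).trans (by linarith))
  · rw [real_pdfMeasure_mixL_Iio hε₀ hε₁ hτ (sub_nonneg.2 hsa)]
    refine hlower.trans ?_
    gcongr
    exact le_add_of_nonneg_right (by positivity)
  · rwa [real_pdfMeasure_mixL_Ioi hε₀ hε₁ (hτ.trans hτa) hτa]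

theorem measure_gt_sInf_le {Ω : Type*} [MeasurableSpace Ω] (ν : Measure Ω) (g : Ω → ℝ)
    (c : ENNReal) (hne : {t : ℝ | ν {ω | g ω > t} ≤ c}.Nonempty) :
    ν {ω | g ω > sInf {t : ℝ | ν {ω | g ω > t} ≤ c}} ≤ c := by
  set q := sInf {t : ℝ | ν {ω | g ω > t} ≤ c}
  have hunion : {ω | g ω > q} = ⋃ m : ℕ, {ω | g ω > q + 1 / ((m : ℝ) + 1)} := by
    ext ω
    simp only [mem_ofPred_eq, mem_iUnion]
    constructor
    · intro h
      obtain ⟨m, hm⟩ := exists_nat_one_div_lt (sub_pos.2 h)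
      exact ⟨m, by linarith⟩
    · rintro ⟨m, hm⟩
      have : 0 < 1 / ((m : ℝ) + 1) := by positivity
      linarith
  rw [hunion, Monotone.measure_iUnion]
  · refine iSup_le fun m => ?_
    obtain ⟨t, ht, htq⟩ := exists_lt_of_csInf_lt hne
      (lt_add_of_pos_right q (by positivity : 0 < 1 / ((m : ℝ) + 1)))
    exact (measure_mono fun ω hω => htq.trans hω).trans ht
  · intro i j hij ω hω
    have : 1 / ((j : ℝ) + 1) ≤ 1 / ((i : ℝ) + 1) := by gcongr
    simp only [mem_ofPred_eq] at hω ⊢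
    linarith

theorem bounds_of_mem_Kfin {n k : ℕ} (hn : 2 ≤ n) (hk : k ∈ Kfin n) : 1 ≤ k ∧ 2 * k ≤ n := by
  obtain ⟨j, hj, rfl⟩ := Finset.mem_image.1 hk
  have h₁ : 2 ^ j ≤ n / 2 := Nat.pow_le_of_le_log (by omega) (Nat.lt_succ_iff.1
    (Finset.mem_range.1 hj))
  exact ⟨Nat.one_le_two_pow, by omega⟩

theorem Kfin_nonempty (n : ℕ) : (Kfin n).Nonempty :=
  (Finset.nonempty_range_iff.2 (Nat.succ_ne_zero _)).image _

theorem card_Kfin_le (n : ℕ) : (Kfin n).card ≤ Nat.log 2 n + 1 :=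
  Finset.card_image_le.trans (by
    rw [Finset.card_range]
    exact Nat.succ_le_succ (Nat.log_mono_right (Nat.div_le_self n 2)))

open Real in
theorem sampleMeasure_phiL_spacing_gt_spacingQuantile_le {n k : ℕ} (hk : 1 ≤ k) (hkn : 2 * k ≤ n)
    {u : ℝ} (hu : u ∈ Ioo (0 : ℝ) 1) :
    sampleMeasure n phiL {ω | spacing k ω > spacingQuantile n phiL u k} ≤ ENNReal.ofReal u := by
  obtain ⟨hu₀, hu₁⟩ := hu
  have hk' : (1 : ℝ) ≤ k := by exact_mod_cast hk
  have hn : (2 : ℝ) ≤ n := by exact_mod_cast (by omega : 2 ≤ n)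
  refine measure_gt_sInf_le _ _ _ ⟨2 * log (4 * n / u), ?_⟩
  refine (sampleMeasure_phiL_spacing_gt_le (m := u / 8) hk (by omega) (log_nonneg ?_) ?_
    (by linarith)).trans (ENNReal.ofReal_le_ofReal ?_)
  · rw [le_div_iff₀ hu₀]
    linarith
  · rw [exp_neg, exp_log (by positivity)]
    field_simp
    norm_num
  · have h : 1 / 4 ≤ ((k : ℝ) - u / 8) ^ 2 := by nlinarith
    calc 2 * (u / 8 / ((k : ℝ) - u / 8) ^ 2) ≤ 2 * (u / 8 / (1 / 4)) := by gcongr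
      _ = u := by ring

theorem div_card_Kfin_le_alphaN {n : ℕ} (hn : 2 ≤ n) {α : ℝ} (hα : α ∈ Ioo (0 : ℝ) 1) :
    α / (Kfin n).card ≤ alphaN n phiL α := by
  have hcard : (1 : ℝ) ≤ (Kfin n).card := by exact_mod_cast (Kfin_nonempty n).card_pos
  have hu : α / (Kfin n).card ∈ Ioo (0 : ℝ) 1 :=
    ⟨div_pos hα.1 (by linarith), (div_le_self hα.1.le hcard).trans_lt hα.2⟩
  refine le_csSup ⟨1, fun u h => h.1.2.le⟩ ⟨hu, ?_⟩
  have hunion : {ω : Fin n → ℝ | ∃ k ∈ Kfin n, spacing k ω >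
      spacingQuantile n phiL (α / (Kfin n).card) k} = ⋃ k ∈ Kfin n, {ω | spacing k ω >
      spacingQuantile n phiL (α / (Kfin n).card) k} := by
    ext ω
    simp
  rw [hunion]
  calc _ ≤ ∑ k ∈ Kfin n, sampleMeasure n phiL {ω | spacing k ω >
          spacingQuantile n phiL (α / (Kfin n).card) k} := measure_biUnion_finset_le _ _
    _ ≤ ∑ _k ∈ Kfin n, ENNReal.ofReal (α / (Kfin n).card) := Finset.sum_le_sum fun k hk =>
        sampleMeasure_phiL_spacing_gt_spacingQuantile_le (bounds_of_mem_Kfin hn hk).1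
          (bounds_of_mem_Kfin hn hk).2 hu
    _ = ENNReal.ofReal α := by
        rw [Finset.sum_const, ← ENNReal.ofReal_nsmul, nsmul_eq_mul, mul_div_cancel₀]
        linarith

theorem spacingQuantile_alphaN_le {n k : ℕ} (hn : 2 ≤ n) {α : ℝ} (hα : α ∈ Ioo (0 : ℝ) 1)
    {T : ℝ} (hT : 0 ≤ T)
    (h : sampleMeasure n phiL {ω | spacing k ω > T} ≤ ENNReal.ofReal (α / (Kfin n).card)) :
    spacingQuantile n phiL (alphaN n phiL α) k ≤ T := by
  have hmem : T ∈ {t : ℝ | sampleMeasure n phiL {ω | spacing k ω > t}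
      ≤ ENNReal.ofReal (alphaN n phiL α)} :=
    h.trans (ENNReal.ofReal_le_ofReal (div_card_Kfin_le_alphaN hn hα))
  rw [spacingQuantile]
  by_cases hb : BddBelow {t : ℝ | sampleMeasure n phiL {ω | spacing k ω > t}
      ≤ ENNReal.ofReal (alphaN n phiL α)}
  · exact csInf_le hb hmem
  · rwa [Real.sInf_of_not_bddBelow hb]

open Real in
/-- If the sample size `k * η ^ 2` dominates the noise and the relative tail inflation
`ε * (exp τ - 1)` dominates `η`, then the spacing test detects the mixture at index `k`. -/
theorem sampleMeasure_mixL_compl_psiReject_le {n k : ℕ} (hn : 2 ≤ n) (hkK : k ∈ Kfin n)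
    {α β ε μ₁ τ η : ℝ} (hα : α ∈ Ioo (0 : ℝ) 1) (hε₀ : 0 ≤ ε) (hε₁ : ε ≤ 1) (hτ : 2 ≤ exp τ)
    (hη₀ : 0 < η) (hη₁ : η ≤ 1 / 16) (hεη : ε ≤ η) (hη : 32 * η ≤ ε * (exp τ - 1))
    (hkτ : 2 * k * exp τ ≤ n) (hnull : 2 / (k * η ^ 2) ≤ α / (Kfin n).card)
    (halt : 4 / (k * η ^ 2) ≤ β) :
    sampleMeasure n (mixL ε μ₁ (μ₁ + τ)) (psiReject n phiL α)ᶜ ≤ ENNReal.ofReal β := by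
  obtain ⟨hk, hkn⟩ := bounds_of_mem_Kfin hn hkK
  have hk₀ : (0 : ℝ) < k := by exact_mod_cast hk
  have hn₀ : (0 : ℝ) < n := by exact_mod_cast (by omega : 0 < n)
  have hτ₀ : 0 ≤ τ := exp_le_exp.1 (by rw [exp_zero]; linarith)
  have hη' : 0 < 1 - η := by linarith
  set m : ℝ := k * (1 - η) with hm
  have hm₀ : 0 < m := by positivity
  have hmk : m < k := by nlinarith
  set a : ℝ := log (n / (2 * m)) with ha
  set s : ℝ := log (1 + 8 * η) with hs
  have hexpa : exp a = n / (2 * m) := exp_log (by positivity)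
  have hexps : exp s = 1 + 8 * η := exp_log (by positivity)
  have hs₀ : 0 ≤ s := log_nonneg (by linarith)
  have hτa : τ ≤ a := by
    rw [← exp_le_exp, hexpa, le_div_iff₀ (by positivity)]
    nlinarith [exp_pos τ]
  have hsa : s ≤ a := by
    refine le_trans ?_ hτa
    rw [← exp_le_exp, hexps]
    linarith
  have hna : n * (exp (-a) / 2) = m := by
    rw [exp_neg, hexpa]
    field_simp
  have hnullk : sampleMeasure n phiL {ω | spacing k ω > 2 * a}
      ≤ ENNReal.ofReal (α / (Kfin n).card) := by
    refine (sampleMeasure_phiL_spacing_gt_le hk (by omega) (hτ₀.trans hτa) hna hmk).trans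
      (ENNReal.ofReal_le_ofReal (le_trans ?_ hnull))
    rw [hm, show (k : ℝ) - k * (1 - η) = k * η by ring]
    calc 2 * (k * (1 - η) / (k * η) ^ 2) = 2 * (1 - η) / (k * η ^ 2) := by field_simp
      _ ≤ 2 / (k * η ^ 2) := by
        gcongr
        linarith
  have hq := spacingQuantile_alphaN_le hn hα (by linarith : 0 ≤ 2 * a) hnullk
  refine (measure_mono ?_).trans ((sampleMeasure_mixL_spacing_le_le (M := k * (1 + η)) hk (by omega)
    hε₀ hε₁ hτ₀ (by linarith : τ ≤ a + s) hsa (by nlinarith) ?_ ?_).trans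
    (ENNReal.ofReal_le_ofReal (le_trans ?_ halt)))
  · intro ω hω
    by_contra h
    exact hω ⟨k, hkK, hq.trans_lt (not_le.1 h)⟩
  · calc k * (1 + η) ≤ k * ((1 - η) * (1 + 8 * η) * (1 - ε)) := by
          gcongr
          have : (1 - η) * (1 + 8 * η) * (1 - η) ≤ (1 - η) * (1 + 8 * η) * (1 - ε) := by gcongr
          nlinarith [mul_nonneg hη₀.le (sub_nonneg.2 hη₁), pow_pos hη₀ 3]
      _ = n * (exp (-a) / 2) * exp s * (1 - ε) := by rw [hna, hexps]; ring
      _ = n * (exp (-(a - s)) / 2 * (1 - ε)) := by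
          rw [show -(a - s) = -a + s by ring, exp_add]; ring
  · calc k * (1 + η) ≤ k * ((1 - η) * (1 + ε * (exp τ - 1)) / (1 + 8 * η)) := by
          gcongr
          rw [le_div_iff₀ (by positivity)]
          have : (1 - η) * (1 + 32 * η) ≤ (1 - η) * (1 + ε * (exp τ - 1)) := by gcongr
          nlinarith [mul_nonneg hη₀.le (sub_nonneg.2 hη₁)]
      _ = n * (exp (-a) / 2) * (exp s)⁻¹ * (1 + ε * (exp τ - 1)) := by
          rw [hna, hexps]; ring
      _ = n * (exp (-(a + s)) / 2 * (1 + ε * (exp τ - 1))) := by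
          rw [show -(a + s) = -a + -s by ring, exp_add, exp_neg s]; ring
  · rw [show (k : ℝ) * (1 + η) - k = k * η by ring]
    calc 2 * (k * (1 + η) / (k * η) ^ 2) = 2 * (1 + η) / (k * η ^ 2) := by field_simp
      _ ≤ 4 / (k * η ^ 2) := by
        gcongr
        linarith

open Real in
theorem eventually_const_mul_log_two_add_one_le_rpow {c : ℝ} (hc : 0 < c) (C : ℝ) :
    ∀ᶠ n : ℕ in atTop, C * (Nat.log 2 n + 1) ≤ (n : ℝ) ^ c := by
  have h₁ : (fun x : ℝ => |C| * (log x / log 2 + 1)) =o[atTop] fun x => x ^ c := by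
    refine Asymptotics.IsLittleO.const_mul_left (Asymptotics.IsLittleO.add ?_ ?_) _
    · simpa only [div_eq_inv_mul] using (isLittleO_log_rpow_atTop hc).const_mul_left (log 2)⁻¹
    · exact Asymptotics.isLittleO_const_left.2 (Or.inr
        (tendsto_norm_atTop_atTop.comp (tendsto_rpow_atTop hc)))
  filter_upwards [tendsto_natCast_atTop_atTop.eventually (h₁.bound zero_lt_one)] with n hn
  rw [one_mul, norm_eq_abs, norm_eq_abs, abs_of_nonneg (rpow_nonneg n.cast_nonneg c)] at hn
  calc C * (Nat.log 2 n + 1) ≤ |C| * (log n / log 2 + 1) := by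
        have := natLog_le_logb n 2
        rw [← log_div_log] at this
        push_cast at this
        gcongr
        exact le_abs_self C
    _ ≤ _ := (le_abs_self _).trans hn

open Real in
theorem eventually_rpow_le_exp_le_rpow {τ : ℕ → ℝ} {r r₁ r₂ : ℝ} (hr : 0 < r) (h₁ : r₁ < r)
    (h₂ : r < r₂) (hτ : Tendsto (fun n : ℕ => τ n / (r * log (n : ℝ))) atTop (nhds 1)) :
    ∀ᶠ n : ℕ in atTop, (n : ℝ) ^ r₁ ≤ exp (τ n) ∧ exp (τ n) ≤ (n : ℝ) ^ r₂ := by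
  filter_upwards [hτ.eventually_const_lt ((div_lt_one hr).2 h₁),
    hτ.eventually_lt_const ((one_lt_div hr).2 h₂), eventually_gt_atTop 1] with n hl hu hn
  have hn₁ : (1 : ℝ) < n := by exact_mod_cast hn
  have hlog := log_pos hn₁
  rw [rpow_def_of_pos (by linarith), rpow_def_of_pos (by linarith), exp_le_exp, exp_le_exp]
  rw [lt_div_iff₀ (by positivity)] at hl
  rw [div_lt_iff₀ (by positivity)] at hu
  have e₁ : r₁ / r * (r * log n) = log n * r₁ := by field_simp
  have e₂ : r₂ / r * (r * log n) = log n * r₂ := by field_simp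
  exact ⟨by linarith, by linarith⟩

theorem exists_mem_Kfin_between {n : ℕ} {x : ℝ} (hx : 1 ≤ x) (hxn : x ≤ (n : ℝ) / 2) :
    ∃ k ∈ Kfin n, (k : ℝ) ≤ x ∧ x / 2 ≤ k := by
  have hfl : ⌊x⌋₊ ≠ 0 := (Nat.floor_pos.2 hx).ne'
  have hle : ⌊x⌋₊ ≤ n / 2 := by
    rw [Nat.le_div_iff_mul_le two_pos]
    have := Nat.floor_le (zero_le_one.trans hx)
    exact_mod_cast (by linarith : (⌊x⌋₊ : ℝ) * 2 ≤ n)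
  refine ⟨2 ^ Nat.log 2 ⌊x⌋₊, Finset.mem_image.2 ⟨_, Finset.mem_range.2
    (Nat.lt_succ_of_le (Nat.log_mono_right hle)), rfl⟩, ?_, ?_⟩
  · exact (Nat.cast_le.2 (Nat.pow_log_le_self 2 hfl)).trans (Nat.floor_le (zero_le_one.trans hx))
  · have h₁ : ⌊x⌋₊ + 1 ≤ 2 ^ Nat.log 2 ⌊x⌋₊ * 2 := by
      rw [← pow_succ]
      exact Nat.lt_pow_succ_log_self one_lt_two _
    have h₂ : (⌊x⌋₊ : ℝ) + 1 ≤ (2 ^ Nat.log 2 ⌊x⌋₊ : ℕ) * 2 := by exact_mod_cast h₁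
    linarith [Nat.lt_floor_add_one x]

open Real in
theorem rpow_le_mul_sq_mul_of_rpow_le {n δ c r₁ ε E : ℝ} (hn : 1 ≤ n) (hc : c < 1 - 2 * δ + r₁)
    (hE : n ^ r₁ ≤ E) (hε : 1 / 2 < ε * n ^ δ) : n ^ c ≤ 4 * (n * ε ^ 2 * E) := by
  have hn₀ : 0 < n := by linarith
  have hsq : 1 ≤ 4 * (ε * n ^ δ) ^ 2 := by nlinarith
  have hmain : n ^ c * (n ^ δ) ^ 2 ≤ n * E := by
    calc n ^ c * (n ^ δ) ^ 2 = n ^ (c + δ + δ) := by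
          rw [rpow_add hn₀, rpow_add hn₀]; ring
      _ ≤ n ^ (1 + r₁) := rpow_le_rpow_of_exponent_le hn (by linarith)
      _ = n * n ^ r₁ := by rw [rpow_add hn₀, rpow_one]
      _ ≤ n * E := by gcongr
  calc n ^ c ≤ n ^ c * (4 * (ε * n ^ δ) ^ 2) := le_mul_of_one_le_right (by positivity) hsq
    _ = 4 * ε ^ 2 * (n ^ c * (n ^ δ) ^ 2) := by ring
    _ ≤ 4 * ε ^ 2 * (n * E) := by gcongr
    _ = 4 * (n * ε ^ 2 * E) := by ring

open Real in
theorem rpow_le_div_of_le_rpow {n c r₂ E : ℝ} (hn : 1 ≤ n) (hc : c < 1 - r₂) (hE₀ : 0 < E)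
    (hE : E ≤ n ^ r₂) : n ^ c ≤ n / E := by
  have hn₀ : 0 < n := by linarith
  rw [le_div_iff₀ hE₀]
  calc n ^ c * E ≤ n ^ c * n ^ r₂ := by gcongr
    _ = n ^ (c + r₂) := (rpow_add hn₀ _ _).symm
    _ ≤ n ^ (1 : ℝ) := rpow_le_rpow_of_exponent_le hn (by linarith)
    _ = n := rpow_one _

open Real in
/-- Non-asymptotic power bound for the spacing test, with the index `k ≈ n / (2 * exp τ)`. -/
theorem sampleMeasure_mixL_compl_psiReject_le_of_rate {n : ℕ} (hn : 2 ≤ n)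
    {α β ε μ₁ τ R : ℝ} (hα : α ∈ Ioo (0 : ℝ) 1) (hβ₀ : 0 < β) (hε₀ : 0 < ε) (hε₁ : ε ≤ 1 / 16)
    (hτ : 33 ≤ exp τ) (hR : 2 ≤ R) (hRτ : R ≤ n / exp τ) (hRε : R ≤ 4 * (n * ε ^ 2 * exp τ))
    (hRlog : 65536 * (4 / β + 2 / α) * (Nat.log 2 n + 1) ≤ R) :
    sampleMeasure n (mixL ε μ₁ (μ₁ + τ)) (psiReject n phiL α)ᶜ ≤ ENNReal.ofReal β := by
  have hα₀ := hα.1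
  have hn₀ : (0 : ℝ) < n := by exact_mod_cast (by omega : 0 < n)
  have hE₀ : 0 < exp τ := exp_pos _
  obtain ⟨k, hkK, hkle, hkge⟩ := exists_mem_Kfin_between (n := n) (x := n / exp τ / 2)
    (by linarith) (by
    have : (n : ℝ) / exp τ ≤ n := div_le_self hn₀.le (by linarith)
    linarith)
  have hk₀ : (0 : ℝ) < k := by exact_mod_cast (bounds_of_mem_Kfin hn hkK).1
  set η := min (1 / 16) (ε * (exp τ - 1) / 32) with hη
  have hη₀ : 0 < η := lt_min (by norm_num) (by
    have : 0 < exp τ - 1 := by linarith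
    positivity)
  have hkη : R ≤ 65536 * (k * η ^ 2) := by
    rcases min_choice (1 / 16) (ε * (exp τ - 1) / 32) with h | h
    · rw [hη, h]
      linarith [hRτ, hkge]
    · rw [hη, h]
      have hE2 : exp τ / 2 ≤ exp τ - 1 := by linarith
      calc R ≤ 4 * (n * ε ^ 2 * exp τ) := hRε
        _ = 65536 * (n / exp τ / 2 / 2 * (ε * (exp τ / 2) / 32) ^ 2) := by
            field_simp
            norm_num
        _ ≤ 65536 * (k * (ε * (exp τ - 1) / 32) ^ 2) := by gcongr
  have hcard : ((Kfin n).card : ℝ) ≤ Nat.log 2 n + 1 := by exact_mod_cast card_Kfin_le n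
  have hcard₁ : (1 : ℝ) ≤ (Kfin n).card := by exact_mod_cast (Kfin_nonempty n).card_pos
  have hbound : (4 / β + 2 / α) * (Kfin n).card ≤ k * η ^ 2 := by
    have : (4 / β + 2 / α) * (Kfin n).card ≤ (4 / β + 2 / α) * (Nat.log 2 n + 1) := by gcongr
    linarith
  have hβ4 : 0 < 4 / β := by positivity
  have hα2 : 0 < 2 / α := by positivity
  refine sampleMeasure_mixL_compl_psiReject_le hn hkK hα hε₀.le (by linarith) (by linarith) hη₀
    (min_le_left _ _) (le_min ?_ ?_) ?_ ?_ ?_ ?_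
  · exact hε₁
  · rw [le_div_iff₀ (by norm_num)]
    gcongr
    linarith
  · have := min_le_right (1 / 16) (ε * (exp τ - 1) / 32)
    linarith
  · calc 2 * k * exp τ ≤ 2 * (n / exp τ / 2) * exp τ := by gcongr
      _ = n := by field_simp
  · rw [div_le_iff₀ (by positivity)]
    calc (2 : ℝ) = α / (Kfin n).card * (2 / α * (Kfin n).card) := by field_simp
      _ ≤ α / (Kfin n).card * (k * η ^ 2) :=
        mul_le_mul_of_nonneg_left (by nlinarith) (by positivity)
  · rw [div_le_iff₀ (by positivity)]
    calc (4 : ℝ) = β * (4 / β) := by field_simp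
      _ ≤ β * (k * η ^ 2) := mul_le_mul_of_nonneg_left (by nlinarith) hβ₀.le

/-- the spacing test `Ψ_α` is powerful in the sparse Laplace regime
above the detection boundary `r*(δ) = 2δ - 1` (Theorem `sparse:Laplace`). -/
theorem stmt5 (α β δ r : ℝ)
    (hα : α ∈ Set.Ioo (0:ℝ) 1) (hβ : β ∈ Set.Ioo (0:ℝ) (1 - α))
    (hδ : 1 / 2 < δ) (hδ1 : δ < 1) (hr0 : 0 < r) (hr1 : r < 1)
    (hrstar : r > 2 * δ - 1)
    (ε τ μ₁ : ℕ → ℝ)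
    (hε : ∀ n, ε n ∈ Set.Ioo (0:ℝ) 1) (hτ : ∀ n, 0 < τ n)
    (hεlim : Filter.Tendsto (fun n : ℕ => ε n * (n : ℝ) ^ δ) Filter.atTop (nhds 1))
    (hτlim : Filter.Tendsto (fun n : ℕ => τ n / (r * Real.log (n : ℝ)))
      Filter.atTop (nhds 1)) :
    ∀ᶠ n : ℕ in Filter.atTop,
      sampleMeasure n (mixL (ε n) (μ₁ n) (μ₁ n + τ n)) (psiReject n phiL α)ᶜ
        ≤ ENNReal.ofReal β := by
  obtain ⟨r₁, hr₁, hr₁r⟩ := exists_between hrstar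
  obtain ⟨r₂, hrr₂, hr₂⟩ := exists_between hr1
  obtain ⟨c, hc₀, hc⟩ := exists_between
    (lt_min (sub_pos.2 hr₂) (by linarith : 0 < 1 - 2 * δ + r₁))
  obtain ⟨hc₂, hc₁⟩ := lt_min_iff.1 hc
  filter_upwards [eventually_rpow_le_exp_le_rpow hr0 hr₁r hrr₂ hτlim,
    hεlim.eventually_const_lt (by norm_num : (1 / 2 : ℝ) < 1),
    hεlim.eventually_lt_const (by norm_num : (1 : ℝ) < 2), eventually_ge_atTop 2,
    ((tendsto_rpow_atTop (by linarith : 0 < r₁)).comp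
      tendsto_natCast_atTop_atTop).eventually_ge_atTop 33,
    ((tendsto_rpow_atTop (by linarith : 0 < δ)).comp
      tendsto_natCast_atTop_atTop).eventually_ge_atTop 32,
    ((tendsto_rpow_atTop hc₀).comp tendsto_natCast_atTop_atTop).eventually_ge_atTop 2,
    eventually_const_mul_log_two_add_one_le_rpow hc₀ (65536 * (4 / β + 2 / α))]
    with n ⟨hexpl, hexpu⟩ hεl hεu hn h33 h32 hc2 hlog
  simp only [Function.comp_apply] at h33 h32 hc2
  have hn₁ : (1 : ℝ) ≤ n := by exact_mod_cast (by omega : 1 ≤ n)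
  obtain ⟨hε₀, hε₁⟩ := hε n
  refine sampleMeasure_mixL_compl_psiReject_le_of_rate hn hα hβ.1 hε₀ ?_ (h33.trans hexpl) hc2
    (rpow_le_div_of_le_rpow hn₁ hc₂ (Real.exp_pos _) hexpu)
    (rpow_le_mul_sq_mul_of_rpow_le hn₁ hc₁ hexpl hεl) hlog
  nlinarith
end
end

section
/- General non-asymptotic power result. Let φ be an even continuous probability density on ℝ with cdf Φ and Φ̄ = 1-Φ. Let α ∈ (0,1), β ∈ (0,1-α), and assume n ≥ 8·log(4/α_n). For k ∈ {1,…,n/2} with k > 2log(4/α_n), define t_{α_n,k} > 0 by Φ̄(t_{α_n,k}/2) = (k/n)·[1 - √(2log(4/α_n)/k)] (t_{α_n,k} = +∞ otherwise), and for ρ > 0 let S̄(α_n,ρ,k) be the set of triples (ε,μ₁,μ₂) ∈ (0,1)×ℝ², μ₂ > μ₁, such that for some c ∈ ℝ: (1-ε)Φ̄(t_{α_n,k} - c + ε(μ₂-μ₁)) + εΦ̄(t_{α_n,k} - c - (1-ε)(μ₂-μ₁)) > ρ and (1-ε)Φ̄(c - ε(μ₂-μ₁)) + εΦ̄(c + (1-ε)(μ₂-μ₁))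 > ρ. Set ρ(k,n) = k/n + (1 + √(1+2kβ))/(nβ) and F̄₁[n,α,β] = {f = (1-ε)φ(·-μ₁) + εφ(·-μ₂) : (ε,μ₁,μ₂) ∈ ∪_{k∈K_n} S̄(α_n,ρ(k,n),k)}. Then Ψ_α is a level-α test and sup_{f ∈ F̄₁[n,α,β]} P_f(Ψ_α = 0) ≤ β. -/
open MeasureTheory Filter Set

noncomputable section

open ProbabilityTheory in
theorem continuous_cdf_of_forall_measure_singleton {ν : Measure ℝ} [IsProbabilityMeasure ν]
    (h : ∀ x, ν {x} = 0) : Continuous (cdf ν) := by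
  rw [continuous_iff_continuousAt]
  intro x
  have hm : Monotone (cdf ν) := monotone_cdf ν
  rw [hm.continuousAt_iff_leftLim_eq_rightLim]
  have h1 := (cdf ν).measure_singleton x
  rw [measure_cdf, h, eq_comm, ENNReal.ofReal_eq_zero] at h1
  rw [StieltjesFunction.rightLim_eq]
  exact le_antisymm (hm.leftLim_le le_rfl) (by linarith)

open ProbabilityTheory in
theorem measure_Ioi_le_ofReal_iff {ν : Measure ℝ} [IsProbabilityMeasure ν] {u : ℝ} (hu : 0 ≤ u)
    (t : ℝ) : ν (Ioi t) ≤ ENNReal.ofReal u ↔ 1 - u ≤ cdf ν t := by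
  rw [ENNReal.le_ofReal_iff_toReal_le (measure_ne_top _ _) hu, ← measureReal_def, cdf_eq_real,
    ← compl_Iic, probReal_compl_eq_one_sub measurableSet_Iic]
  constructor <;> intro h <;> linarith

open ProbabilityTheory in
theorem bddBelow_measure_Ioi_le {ν : Measure ℝ} [IsProbabilityMeasure ν] {u : ℝ}
    (hu : u ∈ Ioo (0:ℝ) 1) : BddBelow {t : ℝ | ν (Ioi t) ≤ ENNReal.ofReal u} := by
  simp_rw [measure_Ioi_le_ofReal_iff hu.1.le]
  obtain ⟨a, ha⟩ := ((tendsto_cdf_atBot ν).eventually_lt_const (sub_pos.2 hu.2)).exists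
  exact ⟨a, fun t ht => le_of_not_ge fun hta =>
    absurd (monotone_cdf ν hta) (not_le.2 (ha.trans_le ht))⟩

open ProbabilityTheory in
theorem measure_Ioi_sInf_eq {ν : Measure ℝ} [IsProbabilityMeasure ν]
    (h : ∀ x, ν {x} = 0) {u : ℝ} (hu : u ∈ Ioo (0:ℝ) 1) :
    ν (Ioi (sInf {t : ℝ | ν (Ioi t) ≤ ENNReal.ofReal u})) = ENNReal.ofReal u := by
  have hb := bddBelow_measure_Ioi_le (ν := ν) hu
  simp_rw [measure_Ioi_le_ofReal_iff hu.1.le] at hb ⊢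
  have hc := continuous_cdf_of_forall_measure_singleton h
  set s := {t : ℝ | 1 - u ≤ cdf ν t} with hs
  have hne : s.Nonempty := by
    obtain ⟨a, ha⟩ := ((tendsto_cdf_atTop ν).eventually_const_lt
      (show 1 - u < 1 by linarith [hu.1])).exists
    exact ⟨a, ha.le⟩
  have hmem : sInf s ∈ s := (isClosed_le continuous_const hc).csInf_mem hne hb
  have hle : cdf ν (sInf s) ≤ 1 - u := by
    refine le_of_tendsto (hc.continuousWithinAt (s := Iio (sInf s))) ?_
    filter_upwards [self_mem_nhdsWithin] with t ht
    exact le_of_not_ge fun h' => notMem_of_lt_csInf ht hb h'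
  have heq : cdf ν (sInf s) = 1 - u := le_antisymm hle hmem
  rw [← compl_Iic, ← ENNReal.ofReal_toReal (measure_ne_top ν _), ← measureReal_def,
    probReal_compl_eq_one_sub measurableSet_Iic, ← cdf_eq_real, heq]
  congr 1
  ring

theorem oStat_mem_iff {n k : ℕ} (hk : 1 ≤ k) (hkn : k ≤ n) (ω : Fin n → ℝ) {s : Set ℝ}
    (hs : IsLowerSet s) [DecidablePred (· ∈ s)] :
    oStat k ω ∈ s ↔ k ≤ (Finset.univ.filter fun i => ω i ∈ s).card := by
  have hmono := Tuple.monotone_sort ω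
  have hcard : (Finset.univ.filter fun i => ω i ∈ s).card
      = (Finset.univ.filter fun i => ω (Tuple.sort ω i) ∈ s).card := by
    refine (Finset.card_bij (fun i _ => Tuple.sort ω i) ?_ ?_ ?_).symm
    · intro i hi
      simpa using hi
    · intro i _ j _ h
      exact (Tuple.sort ω).injective h
    · intro j hj
      exact ⟨(Tuple.sort ω).symm j, by simpa using hj, by simp⟩
  have := Fin.lt_card_filter_univ_iff_apply_of_imp (j := (⟨k - 1, by omega⟩ : Fin n))
    (fun i => ω (Tuple.sort ω i) ∈ s) (fun i j hij h => hs (hmono (by grind)) h)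
  rw [oStat, dif_pos ⟨hk, hkn⟩, ← this, hcard]
  simp only
  omega

theorem oStat_le_iff {n k : ℕ} (hk : 1 ≤ k) (hkn : k ≤ n) (ω : Fin n → ℝ) (x : ℝ) :
    oStat k ω ≤ x ↔ k ≤ (Finset.univ.filter fun i => ω i ≤ x).card :=
  oStat_mem_iff hk hkn ω (isLowerSet_Iic x)

theorem oStat_lt_iff {n k : ℕ} (hk : 1 ≤ k) (hkn : k ≤ n) (ω : Fin n → ℝ) (x : ℝ) :
    oStat k ω < x ↔ k ≤ (Finset.univ.filter fun i => ω i ∈ Iio x).card :=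
  oStat_mem_iff hk hkn ω (isLowerSet_Iio x)

theorem lt_oStat_iff {n k : ℕ} (hk : 1 ≤ k) (hkn : k ≤ n) (ω : Fin n → ℝ) (x : ℝ) :
    x < oStat (n - k + 1) ω ↔ k ≤ (Finset.univ.filter fun i => ω i ∈ Ioi x).card := by
  simp only [mem_Ioi]
  rw [← not_le, oStat_le_iff (by omega) (by omega)]
  have := Finset.card_filter_add_card_filter_not (s := Finset.univ) (fun i => ω i ≤ x)
  simp only [not_le, Finset.card_univ, Fintype.card_fin] at this
  omega

theorem measurable_oStat {n : ℕ} (k : ℕ) : Measurable (oStat k : (Fin n → ℝ) → ℝ) := by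
  by_cases h : 1 ≤ k ∧ k ≤ n
  · refine measurable_of_Iic fun x => ?_
    have : oStat k ⁻¹' Iic x
        = {ω : Fin n → ℝ | k ≤ ∑ i, if ω i ≤ x then 1 else 0} := by
      ext ω
      simp [oStat_le_iff h.1 h.2]
    rw [this]
    refine measurableSet_le measurable_const (Finset.measurable_sum _ fun i _ => ?_)
    exact Measurable.ite (measurableSet_le (measurable_pi_apply i) measurable_const)
      measurable_const measurable_const
  · have : (oStat k : (Fin n → ℝ) → ℝ) = fun _ => 0 := by
      ext ω
      simp [oStat, h]
    rw [this]
    exact measurable_const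

theorem measurable_spacing {n : ℕ} (k : ℕ) : Measurable (spacing k : (Fin n → ℝ) → ℝ) :=
  (measurable_oStat _).sub (measurable_oStat _)

theorem oStat_add_const {n k : ℕ} (hk : 1 ≤ k) (hkn : k ≤ n) (ω : Fin n → ℝ) (c : ℝ) :
    oStat k (fun i => ω i + c) = oStat k ω + c := by
  refine eq_of_forall_ge_iff fun x => ?_
  rw [← le_sub_iff_add_le, oStat_le_iff hk hkn, oStat_le_iff hk hkn]
  simp_rw [le_sub_iff_add_le]

theorem spacing_add_const {n k : ℕ} (hk : 1 ≤ k) (hkn : k ≤ n) (ω : Fin n → ℝ) (c : ℝ) :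
    spacing k (fun i => ω i + c) = spacing k ω := by
  rw [spacing, oStat_add_const (by omega) (by omega), oStat_add_const hk hkn, spacing]
  ring

theorem exists_ne_spacing_eq {n k : ℕ} (hk : 1 ≤ k) (hkn : k ≤ n / 2) (ω : Fin n → ℝ) :
    ∃ i j, i ≠ j ∧ spacing k ω = ω i - ω j := by
  refine ⟨Tuple.sort ω ⟨n - k + 1 - 1, by omega⟩, Tuple.sort ω ⟨k - 1, by omega⟩, ?_, ?_⟩
  · rw [Ne, (Tuple.sort ω).injective.eq_iff, Fin.mk.injEq]
    omega
  · rw [spacing, oStat, oStat, dif_pos (by omega), dif_pos (by omega)]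

theorem mem_Kfin {n k : ℕ} (hn : 2 ≤ n) (hk : k ∈ Kfin n) : 1 ≤ k ∧ k ≤ n / 2 := by
  simp only [Kfin, Finset.mem_image, Finset.mem_range] at hk
  obtain ⟨j, hj, rfl⟩ := hk
  exact ⟨Nat.one_le_two_pow, Nat.pow_le_of_le_log (by omega) (by omega)⟩

theorem measure_pi_sub_eq_const {ι : Type*} [Fintype ι] {ν : Measure ℝ} [IsProbabilityMeasure ν]
    (h : ∀ x, ν {x} = 0) {i j : ι} (hij : i ≠ j) (c : ℝ) :
    Measure.pi (fun _ : ι => ν) {ω | ω i - ω j = c} = 0 := by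
  have hind : ProbabilityTheory.IndepFun (fun ω : ι → ℝ => ω i) (fun ω => ω j)
      (Measure.pi fun _ => ν) :=
    (ProbabilityTheory.iIndepFun_pi (X := fun _ x => x) (μ := fun _ : ι => ν)
      fun _ => aemeasurable_id).indepFun hij
  have hmap := (ProbabilityTheory.indepFun_iff_map_prod_eq_prod_map_map
    (measurable_pi_apply i).aemeasurable (measurable_pi_apply j).aemeasurable).1 hind
  have e : ∀ i : ι, (Measure.pi fun _ : ι => ν).map (fun ω => ω i) = ν :=
    fun i => (measurePreserving_eval (fun _ : ι => ν) i).map_eq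
  rw [e, e] at hmap
  have hms : MeasurableSet {p : ℝ × ℝ | p.1 - p.2 = c} :=
    measurableSet_eq_fun (by fun_prop) measurable_const
  have := Measure.map_apply (μ := Measure.pi fun _ : ι => ν)
    (f := fun ω : ι → ℝ => (ω i, ω j)) (by fun_prop) hms
  rw [hmap] at this
  refine this.symm.trans ((Measure.measure_prod_null hms).2 (Filter.Eventually.of_forall fun x => ?_))
  refine measure_mono_null (t := {x - c}) ?_ (h _)
  intro y hy
  simp only [mem_preimage, mem_ofPred_eq] at hy
  simp only [mem_singleton_iff]
  linarith

theorem isProbabilityMeasure_pdfMeasure {f : ℝ → ℝ} (hf : ∀ x, 0 ≤ f x) (hfi : ∫ x, f x = 1) :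
    IsProbabilityMeasure (pdfMeasure f) := by
  have hint : Integrable f := by
    by_contra h
    simp [integral_undef h] at hfi
  constructor
  rw [pdfMeasure, withDensity_apply _ MeasurableSet.univ, Measure.restrict_univ,
    ← ofReal_integral_eq_lintegral_ofReal hint (Filter.Eventually.of_forall hf), hfi,
    ENNReal.ofReal_one]

theorem pdfMeasure_real_apply {f : ℝ → ℝ} (hf : ∀ x, 0 ≤ f x) (hint : Integrable f)
    {s : Set ℝ} (hs : MeasurableSet s) : (pdfMeasure f).real s = ∫ x in s, f x := by
  rw [measureReal_def, pdfMeasure, withDensity_apply _ hs,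
    ← ofReal_integral_eq_lintegral_ofReal hint.integrableOn (Filter.Eventually.of_forall hf),
    ENNReal.toReal_ofReal (integral_nonneg hf)]

theorem pdfMeasure_singleton (f : ℝ → ℝ) (x : ℝ) : pdfMeasure f {x} = 0 :=
  withDensity_absolutelyContinuous _ _ (measure_singleton x)

theorem pdfMeasure_comp_sub_right {f : ℝ → ℝ} (hf : Measurable f) (μ : ℝ) :
    pdfMeasure (fun x => f (x - μ)) = (pdfMeasure f).map (· + μ) := by
  have hg : Measurable fun x => ENNReal.ofReal (f x) := hf.ennreal_ofReal
  have hmp := measurePreserving_add_right (volume : Measure ℝ) μ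
  ext s hs
  have hpre : MeasurableSet ((· + μ) ⁻¹' s) := hmp.measurable hs
  rw [Measure.map_apply hmp.measurable hs, pdfMeasure, pdfMeasure, withDensity_apply _ hs,
    withDensity_apply _ hpre]
  simpa using (hmp.setLIntegral_comp_preimage hs (hg.comp (measurable_id.sub_const μ))).symm

theorem sampleMeasure_comp_sub_right {f : ℝ → ℝ} (hf : Measurable f)
    [IsProbabilityMeasure (pdfMeasure f)] (n : ℕ) (μ : ℝ) :
    sampleMeasure n (fun x => f (x - μ)) = (sampleMeasure n f).map fun ω i => ω i + μ := by
  have : IsProbabilityMeasure ((pdfMeasure f).map (· + μ)) :=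
    Measure.isProbabilityMeasure_map (by fun_prop)
  rw [sampleMeasure, sampleMeasure, pdfMeasure_comp_sub_right hf]
  exact (Measure.pi_map_pi (μ := fun _ : Fin n => pdfMeasure f) (f := fun _ x => x + μ)
    fun _ => by fun_prop).symm

theorem setIntegral_Ioi_comp_sub_right (f : ℝ → ℝ) (a μ : ℝ) :
    ∫ x in Ioi a, f (x - μ) = ∫ x in Ioi (a - μ), f x := by
  have := (measurePreserving_sub_right (volume : Measure ℝ) μ).setIntegral_preimage_emb
    (MeasurableEquiv.subRight μ).measurableEmbedding f (Ioi (a - μ))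
  simpa using this

theorem setIntegral_Iio_comp_sub_right (f : ℝ → ℝ) (a μ : ℝ) :
    ∫ x in Iio a, f (x - μ) = ∫ x in Iio (a - μ), f x := by
  have := (measurePreserving_sub_right (volume : Measure ℝ) μ).setIntegral_preimage_emb
    (MeasurableEquiv.subRight μ).measurableEmbedding f (Iio (a - μ))
  simpa using this

theorem setIntegral_Ioi_eq_Phibar {φ : ℝ → ℝ} (hint : Integrable φ) (hφ : ∫ x, φ x = 1) (a : ℝ) :
    ∫ x in Ioi a, φ x = Phibar φ a := by
  rw [Phibar, ← hφ, ← compl_Iic, setIntegral_compl measurableSet_Iic hint]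

theorem setIntegral_Iio_eq_Phibar {φ : ℝ → ℝ} (hint : Integrable φ) (hφ : ∫ x, φ x = 1)
    (heven : ∀ x, φ (-x) = φ x) (a : ℝ) : ∫ x in Iio a, φ x = Phibar φ (-a) := by
  rw [← setIntegral_Ioi_eq_Phibar hint hφ, ← integral_comp_neg_Iic, integral_Iic_eq_integral_Iio]
  simp_rw [heven]

theorem mixture_setIntegral {φ : ℝ → ℝ} (hint : Integrable φ) (ε μ₁ μ₂ : ℝ) (s : Set ℝ) :
    ∫ x in s, ((1 - ε) * φ (x - μ₁) + ε * φ (x - μ₂))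
      = (1 - ε) * (∫ x in s, φ (x - μ₁)) + ε * ∫ x in s, φ (x - μ₂) := by
  rw [integral_add ((hint.comp_sub_right μ₁).const_mul _).integrableOn
    ((hint.comp_sub_right μ₂).const_mul _).integrableOn, integral_const_mul, integral_const_mul]

theorem one_sub_mul_exp_le {δ : ℝ} (h0 : 0 ≤ δ) (h1 : δ < 1) :
    (1 - δ) * Real.exp δ ≤ Real.exp (-(δ ^ 2 / 2)) := by
  have hs := Real.hasSum_pow_div_log_of_abs_lt_one (x := δ) (by rwa [abs_of_nonneg h0])
  have h2 := sum_le_hasSum (Finset.range 2) (fun i _ => by positivity) hs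
  simp only [Finset.sum_range_succ, Finset.sum_range_zero] at h2
  norm_num at h2
  rw [← Real.exp_log (sub_pos.2 h1), ← Real.exp_add]
  exact Real.exp_le_exp.2 (by linarith)

section Counting

variable {ι : Type*} [Fintype ι] {ν : Measure ℝ} [IsProbabilityMeasure ν]

open ProbabilityTheory

theorem card_filter_mem_eq_sum_indicator (s : Set ℝ) [DecidablePred (· ∈ s)] (ω : ι → ℝ) :
    ((Finset.univ.filter fun i => ω i ∈ s).card : ℝ)
      = ∑ i, s.indicator (1 : ℝ → ℝ) (ω i) := by
  simp [Set.indicator_apply]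

theorem mgf_indicator_one {s : Set ℝ} (hs : MeasurableSet s) (t : ℝ) :
    mgf (s.indicator (1 : ℝ → ℝ)) ν t = 1 + ν.real s * (Real.exp t - 1) := by
  have : (fun x => Real.exp (t * s.indicator (1 : ℝ → ℝ) x))
      = fun x => 1 + s.indicator (1 : ℝ → ℝ) x * (Real.exp t - 1) := by
    ext x
    by_cases hx : x ∈ s <;> simp [hx]
  have hi : Integrable (s.indicator (1 : ℝ → ℝ)) ν :=
    (integrable_const (1 : ℝ)).indicator hs
  rw [mgf, this, integral_add (integrable_const _) (hi.mul_const _), integral_mul_const,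
    integral_indicator_one hs]
  simp

/-- Chernoff bound for the number of observations falling in a set. -/
theorem measure_le_card_filter_mem_le {s : Set ℝ} (hs : MeasurableSet s)
    [DecidablePred (· ∈ s)] {k : ℕ} {δ : ℝ} (h0 : 0 ≤ δ) (h1 : δ < 1)
    (hp : Fintype.card ι * ν.real s = k * (1 - δ)) :
    Measure.pi (fun _ : ι => ν) {ω | k ≤ (Finset.univ.filter fun i => ω i ∈ s).card}
      ≤ ENNReal.ofReal (Real.exp (-(k * δ ^ 2 / 2))) := by
  set P := Measure.pi (fun _ : ι => ν) with hP
  set N : (ι → ℝ) → ℝ := ∑ i, fun ω => s.indicator (1 : ℝ → ℝ) (ω i) with hN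
  have hδ : 0 < 1 - δ := sub_pos.2 h1
  have hset : {ω : ι → ℝ | k ≤ (Finset.univ.filter fun i => ω i ∈ s).card}
      = {ω | (k : ℝ) ≤ N ω} := by
    ext ω
    simp only [mem_ofPred_eq, hN, Finset.sum_apply]
    rw [← card_filter_mem_eq_sum_indicator, Nat.cast_le]
  set t := -Real.log (1 - δ) with ht
  have ht0 : 0 ≤ t := neg_nonneg.2 (Real.log_nonpos hδ.le (by linarith))
  have hmeas : Measurable (s.indicator (1 : ℝ → ℝ)) := measurable_one.indicator hs
  have hexp : Real.exp t = (1 - δ)⁻¹ := by rw [ht, Real.exp_neg, Real.exp_log hδ]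
  have hmgf : mgf N P t = (1 + ν.real s * (Real.exp t - 1)) ^ Fintype.card ι := by
    rw [hN, (iIndepFun_pi (μ := fun _ : ι => ν) (X := fun _ => s.indicator (1 : ℝ → ℝ))
      fun _ => hmeas.aemeasurable).mgf_sum (fun i => hmeas.comp (measurable_pi_apply i))]
    simp_rw [← mgf_indicator_one (ν := ν) hs t]
    rw [← Finset.card_univ, ← Finset.prod_const]
    refine Finset.prod_congr rfl fun i _ => ?_
    have hmap := (measurePreserving_eval (fun _ : ι => ν) i).map_eq
    conv_rhs => rw [← hmap]
    exact (mgf_map (X := s.indicator (1 : ℝ → ℝ)) (measurable_pi_apply i).aemeasurable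
      (hmeas.const_mul t).exp.aestronglyMeasurable).symm
  have hint : Integrable (fun ω => Real.exp (t * N ω)) P := by
    refine Integrable.of_bound (C := Real.exp (t * Fintype.card ι))
      (by fun_prop) (Filter.Eventually.of_forall fun ω => ?_)
    rw [Real.norm_eq_abs, Real.abs_exp, Real.exp_le_exp, hN, Finset.sum_apply]
    classical
    rw [← card_filter_mem_eq_sum_indicator]
    gcongr
    exact Finset.card_le_univ _
  have hch := measure_ge_le_exp_mul_mgf (μ := P) (X := N) (k : ℝ) ht0 hint
  rw [hset, ← ENNReal.ofReal_toReal (measure_ne_top P _), ← measureReal_def]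
  refine ENNReal.ofReal_le_ofReal (hch.trans ?_)
  rw [hmgf]
  have hle : (1 + ν.real s * (Real.exp t - 1)) ^ Fintype.card ι ≤ Real.exp (k * δ) := by
    have hnn : 0 ≤ ν.real s * (Real.exp t - 1) :=
      mul_nonneg measureReal_nonneg (by linarith [Real.one_le_exp ht0])
    calc _ ≤ Real.exp (ν.real s * (Real.exp t - 1)) ^ Fintype.card ι := by
          gcongr
          linarith [Real.add_one_le_exp (ν.real s * (Real.exp t - 1))]
      _ = Real.exp (k * δ) := by
          rw [← Real.exp_nat_mul, ← mul_assoc, hp, hexp]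
          congr 1
          field_simp
          ring
  have hk : Real.exp (-t * k) = (1 - δ) ^ k := by
    rw [ht, neg_neg, mul_comm, Real.exp_nat_mul, Real.exp_log hδ]
  calc _ ≤ (1 - δ) ^ k * Real.exp (k * δ) := by rw [hk]; gcongr
    _ = ((1 - δ) * Real.exp δ) ^ k := by rw [mul_pow, Real.exp_nat_mul]
    _ ≤ Real.exp (-(δ ^ 2 / 2)) ^ k := by
        gcongr
        exact one_sub_mul_exp_le h0 h1
    _ = _ := by
        rw [← Real.exp_nat_mul]
        congr 1
        ring

/-- Chebyshev bound for the number of observations falling in a set. -/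
theorem measure_card_filter_mem_lt_le {s : Set ℝ} (hs : MeasurableSet s)
    [DecidablePred (· ∈ s)] {k : ℕ} (hk : k < Fintype.card ι * ν.real s) :
    Measure.pi (fun _ : ι => ν) {ω | (Finset.univ.filter fun i => ω i ∈ s).card < k}
      ≤ ENNReal.ofReal (Fintype.card ι * ν.real s / (Fintype.card ι * ν.real s - k) ^ 2) := by
  set P := Measure.pi (fun _ : ι => ν) with hP
  set N : (ι → ℝ) → ℝ := ∑ i, fun ω => s.indicator (1 : ℝ → ℝ) (ω i) with hN
  have hmem : MemLp (s.indicator (1 : ℝ → ℝ)) 2 ν := (memLp_const (1 : ℝ)).indicator hs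
  have hmem' : ∀ i : ι, MemLp (fun ω : ι → ℝ => s.indicator (1 : ℝ → ℝ) (ω i)) 2 P :=
    fun i => hmem.comp_measurePreserving (measurePreserving_eval (fun _ => ν) i)
  have hNmem : MemLp N 2 P := memLp_finsetSum' _ fun i _ => hmem' i
  have hvar : variance N P ≤ Fintype.card ι * ν.real s := by
    rw [hN, hP, variance_sum_pi fun _ => hmem, Finset.sum_const, Finset.card_univ, nsmul_eq_mul]
    gcongr
    refine (variance_le_expectation_sq hmem.aestronglyMeasurable).trans_eq ?_
    rw [← integral_indicator_one hs]
    congr 1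
    ext x
    by_cases hx : x ∈ s <;> simp [hx]
  have hmean : ∫ ω, N ω ∂P = Fintype.card ι * ν.real s := by
    simp only [hN, Finset.sum_apply]
    rw [integral_finsetSum _ fun i _ => (hmem' i).integrable (by norm_num)]
    have : ∀ i : ι, ∫ ω : ι → ℝ, s.indicator (1 : ℝ → ℝ) (ω i) ∂P = ν.real s := fun i => by
      rw [← integral_indicator_one hs]
      have hmap := (measurePreserving_eval (fun _ : ι => ν) i).map_eq
      conv_rhs => rw [← hmap]
      exact (integral_map (measurable_pi_apply i).aemeasurable
        (measurable_one.indicator hs).aestronglyMeasurable).symm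
    simp [this]
  have hpos : 0 < Fintype.card ι * ν.real s - k := sub_pos.2 hk
  refine (measure_mono ?_).trans ((meas_ge_le_variance_div_sq hNmem hpos).trans
    (ENNReal.ofReal_le_ofReal (by gcongr)))
  intro ω hω
  have h1 : N ω < k := by
    simp only [hN, Finset.sum_apply]
    rw [← card_filter_mem_eq_sum_indicator, Nat.cast_lt]
    exact hω
  rw [mem_ofPred_eq, hmean, abs_sub_comm]
  exact (by linarith : _ ≤ _).trans (le_abs_self _)

end Counting

theorem map_spacing_Ioi (φ : ℝ → ℝ) (n k : ℕ) (t : ℝ) :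
    (sampleMeasure n φ).map (spacing k) (Ioi t) = sampleMeasure n φ {ω | spacing k ω > t} :=
  Measure.map_apply (measurable_spacing k) measurableSet_Ioi

theorem bddAbove_alphaN_set (n : ℕ) (φ : ℝ → ℝ) (α : ℝ) : BddAbove {u : ℝ | u ∈ Set.Ioo (0:ℝ) 1 ∧
    sampleMeasure n φ {ω | ∃ k ∈ Kfin n, spacing k ω > spacingQuantile n φ u k}
      ≤ ENNReal.ofReal α} :=
  ⟨1, fun _ hu => hu.1.2.le⟩

theorem one_mem_Kfin (n : ℕ) : 1 ∈ Kfin n :=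
  Finset.mem_image.2 ⟨0, by simp, rfl⟩

theorem spacing_eq_zero_of_lt_two {n : ℕ} (hn : n < 2) {k : ℕ} (hk : k ∈ Kfin n) (ω : Fin n → ℝ) :
    spacing k ω = 0 := by
  have hk1 : k = 1 := by
    have h0 : n / 2 = 0 := by omega
    simpa [Kfin, h0] using hk
  subst hk1
  interval_cases n
  · simp [spacing, oStat]
  · simp [spacing, oStat]

theorem measurableSet_exists_spacing_gt {n : ℕ} (q : ℕ → ℝ) :
    MeasurableSet {ω : Fin n → ℝ | ∃ k ∈ Kfin n, spacing k ω > q k} := by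
  have : {ω : Fin n → ℝ | ∃ k ∈ Kfin n, spacing k ω > q k}
      = ⋃ k ∈ Kfin n, {ω | spacing k ω > q k} := by
    ext
    simp
  rw [this]
  exact Finset.measurableSet_biUnion _ fun k _ =>
    measurableSet_lt measurable_const (measurable_spacing k)

section SpacingTest

variable {φ : ℝ → ℝ} [IsProbabilityMeasure (pdfMeasure φ)] {n : ℕ}

instance : IsProbabilityMeasure (sampleMeasure n φ) := by
  unfold sampleMeasure
  infer_instance

theorem map_spacing_singleton {k : ℕ} (hk : 1 ≤ k) (hkn : k ≤ n / 2) (x : ℝ) :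
    (sampleMeasure n φ).map (spacing k) {x} = 0 := by
  rw [Measure.map_apply (measurable_spacing k) (measurableSet_singleton x)]
  refine measure_mono_null
    (t := ⋃ i : Fin n, ⋃ j : Fin n, ⋃ _ : i ≠ j, {ω : Fin n → ℝ | ω i - ω j = x}) ?_ ?_
  · intro ω hω
    obtain ⟨i, j, hij, h⟩ := exists_ne_spacing_eq hk hkn ω
    simp only [mem_iUnion]
    exact ⟨i, j, hij, h.symm.trans hω⟩
  · simp only [measure_iUnion_null_iff]
    exact fun i j hij => measure_pi_sub_eq_const (pdfMeasure_singleton φ) hij x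

instance (k : ℕ) : IsProbabilityMeasure ((sampleMeasure n φ).map (spacing k)) :=
  Measure.isProbabilityMeasure_map (measurable_spacing k).aemeasurable

theorem measure_spacing_gt_spacingQuantile {k : ℕ} (hk : 1 ≤ k) (hkn : k ≤ n / 2) {u : ℝ}
    (hu : u ∈ Ioo (0:ℝ) 1) :
    sampleMeasure n φ {ω | spacing k ω > spacingQuantile n φ u k} = ENNReal.ofReal u := by
  have := measure_Ioi_sInf_eq (map_spacing_singleton (φ := φ) hk hkn) hu
  simp only [map_spacing_Ioi] at this
  exact this

theorem spacingQuantile_le {k : ℕ} {u t : ℝ} (hu : u ∈ Ioo (0:ℝ) 1)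
    (h : sampleMeasure n φ {ω | spacing k ω > t} ≤ ENNReal.ofReal u) :
    spacingQuantile n φ u k ≤ t := by
  have := bddBelow_measure_Ioi_le (ν := (sampleMeasure n φ).map (spacing k)) hu
  simp only [map_spacing_Ioi] at this
  exact csInf_le this h

theorem exists_mem_alphaN_set (hn : 2 ≤ n) {α : ℝ} (hα : α ∈ Ioo (0:ℝ) 1) :
    ∃ u ∈ Set.Ioo (0:ℝ) 1,
      sampleMeasure n φ {ω | ∃ k ∈ Kfin n, spacing k ω > spacingQuantile n φ u k}
        ≤ ENNReal.ofReal α := by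
  have hcard : 1 ≤ ((Kfin n).card : ℝ) :=
    Nat.one_le_cast.2 (Finset.card_pos.2 ⟨1, one_mem_Kfin n⟩)
  have hu : α / (Kfin n).card ∈ Ioo (0:ℝ) 1 :=
    ⟨div_pos hα.1 (by linarith), (div_le_self hα.1.le hcard).trans_lt hα.2⟩
  refine ⟨_, hu, ?_⟩
  have hset : {ω : Fin n → ℝ | ∃ k ∈ Kfin n,
      spacing k ω > spacingQuantile n φ (α / (Kfin n).card) k}
      = ⋃ k ∈ Kfin n, {ω | spacing k ω > spacingQuantile n φ (α / (Kfin n).card) k} := by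
    ext
    simp
  rw [hset]
  refine (measure_biUnion_finset_le _ _).trans_eq ?_
  rw [Finset.sum_congr rfl fun k hk =>
    measure_spacing_gt_spacingQuantile (mem_Kfin hn hk).1 (mem_Kfin hn hk).2 hu,
    Finset.sum_const, nsmul_eq_mul, ← ENNReal.ofReal_natCast,
    ← ENNReal.ofReal_mul (by positivity)]
  congr 1
  field_simp

theorem alphaN_pos (hn : 2 ≤ n) {α : ℝ} (hα : α ∈ Ioo (0:ℝ) 1) : 0 < alphaN n φ α := by
  obtain ⟨u, hu, h⟩ := exists_mem_alphaN_set (φ := φ) hn hα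
  exact hu.1.trans_le (le_csSup (bddAbove_alphaN_set n φ α) ⟨hu, h⟩)

theorem alphaN_le (hn : 2 ≤ n) {α : ℝ} (hα : α ∈ Ioo (0:ℝ) 1) : alphaN n φ α ≤ α := by
  refine Real.sSup_le (fun u hu => ?_) hα.1.le
  refine (ENNReal.ofReal_le_ofReal_iff hα.1.le).1 (le_trans ?_ hu.2)
  have h1 := mem_Kfin hn (one_mem_Kfin n)
  rw [← measure_spacing_gt_spacingQuantile (φ := φ) h1.1 h1.2 hu.1]
  exact measure_mono fun ω hω => ⟨1, one_mem_Kfin n, hω⟩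

theorem alphaN_mem_Ioo (hn : 2 ≤ n) {α : ℝ} (hα : α ∈ Ioo (0:ℝ) 1) :
    alphaN n φ α ∈ Ioo (0:ℝ) 1 :=
  ⟨alphaN_pos hn hα, (alphaN_le hn hα).trans_lt hα.2⟩

theorem alphaN_pos_of_lt_two (hn : n < 2) (α : ℝ) : 0 < alphaN n φ α := by
  refine (by norm_num : (0:ℝ) < 1 / 2).trans_le
    (le_csSup (bddAbove_alphaN_set n φ α) ⟨by norm_num, ?_⟩)
  have hempty : {ω : Fin n → ℝ | ∃ k ∈ Kfin n,
      spacing k ω > spacingQuantile n φ (1 / 2) k} = ∅ := by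
    refine eq_empty_of_forall_notMem fun ω => ?_
    rintro ⟨k, hk, hω⟩
    rw [spacing_eq_zero_of_lt_two hn hk] at hω
    refine absurd (Real.sInf_nonneg fun t ht => ?_) (not_le.2 hω)
    by_contra! ht0
    have huniv : {ω : Fin n → ℝ | spacing k ω > t} = univ :=
      eq_univ_of_forall fun ω => by
        rw [mem_ofPred_eq, spacing_eq_zero_of_lt_two hn hk]
        exact ht0
    rw [mem_ofPred_eq, huniv, measure_univ, ENNReal.one_le_ofReal] at ht
    norm_num at ht
  rw [hempty, measure_empty]
  exact zero_le

theorem two_le_of_log_alphaN_le {α : ℝ} (hn : 8 * Real.log (4 / alphaN n φ α) ≤ n) : 2 ≤ n := by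
  by_contra! h
  have h0 := alphaN_pos_of_lt_two (φ := φ) h α
  have h1 : alphaN n φ α ≤ 1 := Real.sSup_le (fun u hu => hu.1.2.le) zero_le_one
  have h2 := Real.one_sub_inv_le_log_of_pos (show 0 < 4 / alphaN n φ α by positivity)
  rw [inv_div] at h2
  have h3 : (n : ℝ) ≤ 1 := by exact_mod_cast Nat.lt_succ_iff.1 h
  linarith

theorem sampleMeasure_psiReject_le (hn : 2 ≤ n) {α : ℝ} (hα : α ∈ Ioo (0:ℝ) 1) :
    sampleMeasure n φ (psiReject n φ α) ≤ ENNReal.ofReal α := by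
  set a := alphaN n φ α with ha
  have haI : a ∈ Ioo (0:ℝ) 1 := alphaN_mem_Ioo hn hα
  rw [ENNReal.le_ofReal_iff_toReal_le (measure_ne_top _ _) hα.1.le, ← measureReal_def]
  have hcard : 0 < ((Kfin n).card : ℝ) :=
    Nat.cast_pos.2 (Finset.card_pos.2 ⟨1, one_mem_Kfin n⟩)
  refine le_of_forall_pos_le_add fun e he => ?_
  obtain ⟨u, hu, hau⟩ := exists_lt_of_lt_csSup
    (exists_mem_alphaN_set (φ := φ) hn hα)
    (show a - e / (Kfin n).card < a by linarith [div_pos he hcard])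
  have hua : u ≤ a := le_csSup (bddAbove_alphaN_set n φ α) hu
  have hsub : psiReject n φ α ⊆ {ω | ∃ k ∈ Kfin n, spacing k ω > spacingQuantile n φ u k} ∪
      ⋃ k ∈ Kfin n, {ω | spacing k ω > spacingQuantile n φ a k} \
        {ω | spacing k ω > spacingQuantile n φ u k} := by
    rintro ω ⟨k, hk, hω⟩
    by_cases h : spacing k ω > spacingQuantile n φ u k
    · exact Or.inl ⟨k, hk, h⟩
    · exact Or.inr (mem_biUnion (Finset.mem_coe.2 hk) ⟨hω, h⟩)
  have hdiff : ∀ k ∈ Kfin n, (sampleMeasure n φ).real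
      ({ω | spacing k ω > spacingQuantile n φ a k} \
        {ω | spacing k ω > spacingQuantile n φ u k}) ≤ e / (Kfin n).card := by
    intro k hk
    obtain ⟨hk1, hk2⟩ := mem_Kfin hn hk
    have hmu := measure_spacing_gt_spacingQuantile (φ := φ) hk1 hk2 hu.1
    have hma := measure_spacing_gt_spacingQuantile (φ := φ) hk1 hk2 haI
    have hq : spacingQuantile n φ a k ≤ spacingQuantile n φ u k :=
      spacingQuantile_le haI (hmu.trans_le (ENNReal.ofReal_le_ofReal hua))
    have hss : {ω : Fin n → ℝ | spacing k ω > spacingQuantile n φ u k} ⊆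
        {ω | spacing k ω > spacingQuantile n φ a k} := fun ω hω => lt_of_le_of_lt hq hω
    rw [measureReal_sdiff hss
      (measurableSet_lt measurable_const (measurable_spacing k)), measureReal_def,
      measureReal_def, hmu, hma, ENNReal.toReal_ofReal haI.1.le, ENNReal.toReal_ofReal hu.1.1.le]
    linarith
  refine (measureReal_mono hsub).trans ((measureReal_union_le _ _).trans (add_le_add ?_ ?_))
  · exact ENNReal.toReal_le_of_le_ofReal hα.1.le hu.2
  · refine (measureReal_biUnion_finset_le _ _).trans ((Finset.sum_le_sum hdiff).trans_eq ?_)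
    rw [Finset.sum_const, nsmul_eq_mul]
    field_simp

theorem sampleMeasure_comp_sub_right_psiReject (hφ : Measurable φ) (hn : 2 ≤ n) (α μ : ℝ) :
    sampleMeasure n (fun x => φ (x - μ)) (psiReject n φ α)
      = sampleMeasure n φ (psiReject n φ α) := by
  have hms : MeasurableSet (psiReject n φ α) := measurableSet_exists_spacing_gt _
  rw [sampleMeasure_comp_sub_right hφ, Measure.map_apply (by fun_prop) hms]
  congr 1
  ext ω
  refine exists_congr fun k => and_congr_right fun hk => ?_
  obtain ⟨hk1, hk2⟩ := mem_Kfin hn hk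
  rw [spacing_add_const hk1 (by omega)]

theorem spacingQuantile_alphaN_le_s6 {k : ℕ} (hk : 1 ≤ k) (hkn : k ≤ n / 2) {a t : ℝ}
    (ha : a ∈ Ioo (0:ℝ) 1) (hlog : 2 * Real.log (4 / a) < k)
    (hIoi : (pdfMeasure φ).real (Ioi (t / 2))
      = (k : ℝ) / n * (1 - Real.sqrt (2 * Real.log (4 / a) / k)))
    (hIio : (pdfMeasure φ).real (Iio (-(t / 2)))
      = (k : ℝ) / n * (1 - Real.sqrt (2 * Real.log (4 / a) / k))) :
    spacingQuantile n φ a k ≤ t := by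
  refine spacingQuantile_le ha ?_
  have hk0 : (0 : ℝ) < k := by exact_mod_cast hk
  have hn0 : (0 : ℝ) < n := by
    have : 0 < n := by omega
    exact_mod_cast this
  have hlog0 : 0 ≤ Real.log (4 / a) :=
    Real.log_nonneg ((one_le_div ha.1).2 (by linarith [ha.2]))
  set δ := Real.sqrt (2 * Real.log (4 / a) / k) with hδ
  have hδ0 : 0 ≤ δ := Real.sqrt_nonneg _
  have hδ1 : δ < 1 := by
    rw [hδ, Real.sqrt_lt' one_pos, one_pow, div_lt_one hk0]
    exact hlog
  have hexp : Real.exp (-(k * δ ^ 2 / 2)) = a / 4 := by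
    have : k * δ ^ 2 / 2 = Real.log (4 / a) := by
      rw [hδ, Real.sq_sqrt (by positivity)]
      field_simp
    rw [this, ← Real.log_inv, Real.exp_log (by have := ha.1; positivity), inv_div]
  have hmul : ∀ p : ℝ, p = (k : ℝ) / n * (1 - δ) →
      Fintype.card (Fin n) * p = k * (1 - δ) := by
    rintro p rfl
    rw [Fintype.card_fin]
    field_simp
  have h1 := measure_le_card_filter_mem_le (ι := Fin n) measurableSet_Ioi hδ0 hδ1 (hmul _ hIoi)
  have h2 := measure_le_card_filter_mem_le (ι := Fin n) measurableSet_Iio hδ0 hδ1 (hmul _ hIio)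
  rw [hexp] at h1 h2
  refine (measure_mono (t := {ω | t / 2 < oStat (n - k + 1) ω} ∪
    {ω | oStat k ω < -(t / 2)}) fun ω hω => ?_).trans
    ((measure_union_le _ _).trans ?_)
  · by_contra hnot
    simp only [mem_union, mem_ofPred_eq, not_or, not_lt] at hnot
    simp only [mem_ofPred_eq, spacing] at hω
    linarith
  · have e1 : {ω : Fin n → ℝ | t / 2 < oStat (n - k + 1) ω} = _ :=
      Set.ext fun ω => lt_oStat_iff hk (by omega) ω (t / 2)
    have e2 : {ω : Fin n → ℝ | oStat k ω < -(t / 2)} = _ :=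
      Set.ext fun ω => oStat_lt_iff hk (by omega) ω (-(t / 2))
    rw [e1, e2]
    refine (add_le_add h1 h2).trans ?_
    rw [← ENNReal.ofReal_add (by linarith [ha.1]) (by linarith [ha.1])]
    exact ENNReal.ofReal_le_ofReal (by linarith [ha.1])

end SpacingTest

theorem rhoKn_lt_imp {n k : ℕ} (hn : 0 < n) {β p : ℝ} (hβ : 0 < β) (hp : rhoKn n k β < p) :
    (k : ℝ) < n * p ∧ n * p / (n * p - k) ^ 2 ≤ β / 2 := by
  have hn0 : (0 : ℝ) < n := Nat.cast_pos.2 hn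
  have h1 : k + (1 + Real.sqrt (1 + 2 * k * β)) / β < n * p := by
    calc _ = n * rhoKn n k β := by rw [rhoKn]; field_simp
      _ < n * p := by gcongr
  set r := Real.sqrt (1 + 2 * k * β) with hr
  have hr0 : 0 ≤ r := Real.sqrt_nonneg _
  have hrs : r ^ 2 = 1 + 2 * k * β := Real.sq_sqrt (by positivity)
  have hlt : (1 + r) / β < n * p - k := by linarith
  have hpos : 0 < n * p - k := lt_of_le_of_lt (by positivity) hlt
  refine ⟨by linarith, ?_⟩
  rw [div_lt_iff₀ hβ] at hlt
  set s := n * p - k with hs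
  have hx : n * p = s + k := by rw [hs]; ring
  rw [hx, div_le_iff₀ (by positivity)]
  have h2 : r ^ 2 ≤ (s * β - 1) ^ 2 := by gcongr; linarith
  rw [hrs] at h2
  have h3 : β * (2 * (s + k)) ≤ β * (β * s ^ 2) := by nlinarith
  have := le_of_mul_le_mul_left h3 hβ
  linarith

theorem sampleMeasure_spacing_le_le {g : ℝ → ℝ} [IsProbabilityMeasure (pdfMeasure g)] {n k : ℕ}
    (hk : 1 ≤ k) (hkn : k ≤ n) {β x y : ℝ} (hβ : 0 < β)
    (hIoi : rhoKn n k β < (pdfMeasure g).real (Ioi y))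
    (hIio : rhoKn n k β < (pdfMeasure g).real (Iio x)) :
    sampleMeasure n g {ω | spacing k ω ≤ y - x} ≤ ENNReal.ofReal β := by
  obtain ⟨h1, h1'⟩ := rhoKn_lt_imp (by omega) hβ hIoi
  obtain ⟨h2, h2'⟩ := rhoKn_lt_imp (by omega) hβ hIio
  have b1 := measure_card_filter_mem_lt_le (ι := Fin n) (ν := pdfMeasure g) (k := k) (s := Ioi y)
    measurableSet_Ioi (by rwa [Fintype.card_fin])
  have b2 := measure_card_filter_mem_lt_le (ι := Fin n) (ν := pdfMeasure g) (k := k) (s := Iio x)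
    measurableSet_Iio (by rwa [Fintype.card_fin])
  rw [Fintype.card_fin] at b1 b2
  refine (measure_mono (t := {ω | ¬ y < oStat (n - k + 1) ω} ∪
    {ω | ¬ oStat k ω < x}) fun ω hω => ?_).trans ((measure_union_le _ _).trans ?_)
  · by_contra hnot
    simp only [mem_union, mem_ofPred_eq, not_or, not_not] at hnot
    simp only [mem_ofPred_eq, spacing] at hω
    linarith
  · have e1 : {ω : Fin n → ℝ | ¬ y < oStat (n - k + 1) ω} = _ :=
      Set.ext fun ω => ((lt_oStat_iff hk hkn ω y).not.trans not_le)
    have e2 : {ω : Fin n → ℝ | ¬ oStat k ω < x} = _ :=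
      Set.ext fun ω => ((oStat_lt_iff hk hkn ω x).not.trans not_le)
    rw [e1, e2]
    refine (add_le_add (b1.trans (ENNReal.ofReal_le_ofReal h1'))
      (b2.trans (ENNReal.ofReal_le_ofReal h2'))).trans ?_
    rw [← ENNReal.ofReal_add (by linarith) (by linarith), add_halves]

/-- general non-asymptotic level and power result for the spacing
test `Ψ_α` (Theorem `testStatOrd`). -/
theorem stmt6 (φ : ℝ → ℝ) (hφcont : Continuous φ) (hφnn : ∀ x, 0 ≤ φ x)
    (hφint : ∫ x, φ x = 1) (hφeven : ∀ x, φ (-x) = φ x)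
    (n : ℕ) (α β : ℝ)
    (hα : α ∈ Set.Ioo (0:ℝ) 1) (hβ : β ∈ Set.Ioo (0:ℝ) (1 - α))
    (hn : 8 * Real.log (4 / alphaN n φ α) ≤ (n : ℝ)) :
    -- `Ψ_α` is a level-α test
    (∀ μ : ℝ,
      sampleMeasure n (fun x => φ (x - μ)) (psiReject n φ α) ≤ ENNReal.ofReal α) ∧
    -- power on the alternative set `F̄₁[n,α,β]`
    (∀ ε μ₁ μ₂ : ℝ, ε ∈ Set.Ioo (0:ℝ) 1 → μ₁ < μ₂ →
      (∃ k ∈ Kfin n, 2 * Real.log (4 / alphaN n φ α) < (k : ℝ) ∧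
        ∃ t : ℝ, 0 < t ∧
          Phibar φ (t / 2)
            = ((k : ℝ) / (n : ℝ)) *
                (1 - Real.sqrt (2 * Real.log (4 / alphaN n φ α) / (k : ℝ))) ∧
          ∃ c : ℝ,
            (1 - ε) * Phibar φ (t - c + ε * (μ₂ - μ₁)) +
                ε * Phibar φ (t - c - (1 - ε) * (μ₂ - μ₁)) > rhoKn n k β ∧
            (1 - ε) * Phibar φ (c - ε * (μ₂ - μ₁)) +
                ε * Phibar φ (c + (1 - ε) * (μ₂ - μ₁)) > rhoKn n k β) →
      sampleMeasure n (fun x => (1 - ε) * φ (x - μ₁) + ε * φ (x - μ₂))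
        (psiReject n φ α)ᶜ ≤ ENNReal.ofReal β) := by
  have hint : Integrable φ := by
    by_contra h
    simp [integral_undef h] at hφint
  have := isProbabilityMeasure_pdfMeasure hφnn hφint
  have hn2 : 2 ≤ n := two_le_of_log_alphaN_le hn
  refine ⟨fun μ => ?_, ?_⟩
  · rw [sampleMeasure_comp_sub_right_psiReject hφcont.measurable hn2]
    exact sampleMeasure_psiReject_le hn2 hα
  · rintro ε μ₁ μ₂ hε - ⟨k, hkK, hlog, t, -, htq, c, hc1, hc2⟩
    obtain ⟨hk1, hk2⟩ := mem_Kfin hn2 hkK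
    have hq : spacingQuantile n φ (alphaN n φ α) k ≤ t := by
      refine spacingQuantile_alphaN_le_s6 hk1 hk2 (alphaN_mem_Ioo hn2 hα) hlog ?_ ?_
      · rw [pdfMeasure_real_apply hφnn hint measurableSet_Ioi,
          setIntegral_Ioi_eq_Phibar hint hφint, htq]
      · rw [pdfMeasure_real_apply hφnn hint measurableSet_Iio,
          setIntegral_Iio_eq_Phibar hint hφint hφeven, neg_neg, htq]
    set g : ℝ → ℝ := fun x => (1 - ε) * φ (x - μ₁) + ε * φ (x - μ₂) with hg
    have hgnn : ∀ x, 0 ≤ g x := fun x =>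
      add_nonneg (mul_nonneg (sub_nonneg.2 hε.2.le) (hφnn _)) (mul_nonneg hε.1.le (hφnn _))
    have hgint : Integrable g :=
      ((hint.comp_sub_right μ₁).const_mul _).add ((hint.comp_sub_right μ₂).const_mul _)
    have hg1 : ∫ x, g x = 1 := by
      rw [← setIntegral_univ, hg, mixture_setIntegral hint, setIntegral_univ, setIntegral_univ,
        integral_sub_right_eq_self, integral_sub_right_eq_self, hφint]
      ring
    have := isProbabilityMeasure_pdfMeasure hgnn hg1
    set m := (1 - ε) * μ₁ + ε * μ₂ with hm
    refine (measure_mono fun ω hω => ?_).trans (sampleMeasure_spacing_le_le (x := m - c)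
      (y := m - c + t) hk1 (by omega) hβ.1 ?_ ?_)
    · refine (le_of_not_gt fun h => hω ⟨k, hkK, h⟩ : spacing k ω ≤ _).trans ?_
      linarith
    · rw [pdfMeasure_real_apply hgnn hgint measurableSet_Ioi, mixture_setIntegral hint,
        setIntegral_Ioi_comp_sub_right, setIntegral_Ioi_comp_sub_right,
        setIntegral_Ioi_eq_Phibar hint hφint, setIntegral_Ioi_eq_Phibar hint hφint]
      convert hc1 using 4 <;> (rw [hm]; ring_nf)
    · rw [pdfMeasure_real_apply hgnn hgint measurableSet_Iio, mixture_setIntegral hint,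
        setIntegral_Iio_comp_sub_right, setIntegral_Iio_comp_sub_right,
        setIntegral_Iio_eq_Phibar hint hφint hφeven, setIntegral_Iio_eq_Phibar hint hφint hφeven]
      convert hc2 using 4 <;> (rw [hm]; ring_nf)
end
end
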